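/- arXiv:0806.1975 — 6 statements merged into one kernel-verified Lean document; each statement's English description precedes it below -/
import Mathlib

section
/- Let n ≥ 0 and let g₀,…,gₙ be unit quaternions. For 0 ≤ k ≤ n set c_k = g₀²g₁²⋯g_{k−1}² (so c₀ = 1), and define the ℝ-linear map L : ℍ^{n+1} → ℍ by L(ξ₀,…,ξₙ) = Σ_{k=0}^{n} c_k · (ξ_k + g_k ξ_k g_k⁻¹) · c_k⁻¹ (this is the differential of the map □ₙ(g₀,…,gₙ) = g₀²⋯gₙ² in the right trivialization of the tangent bundle of (S³)^{n+1}). If g₀²g₁²⋯gₙ² ≠ (−1)^{n+1}, then L maps the subspace of (n+1)-tuples of purely imaginary quaternions onto the 3-dimensional space of purely imaginary quaternions. Moreover, for the constant tuple g₀ = ⋯ = gₙ = j (a fixed unit quaternion with j² = −1), the image under L of the tuples of purely imaginary quaternions is not all of the purely imaginary quaternions. Hence (−1)^{n+1} is the only singular value of □ₙ : (S³)^{n+1} → S³. -/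
noncomputable section

/-- `S³`, the group of unit quaternions. -/
abbrev S3 : Type := Metric.sphere (0 : Quaternion ℝ) 1

/-- The ordered partial product `c_k = g₀² g₁² ⋯ g_{k−1}²` (so `c₀ = 1`). -/
def partialProd {n : ℕ} (g : Fin (n + 1) → S3) (k : Fin (n + 1)) : Quaternion ℝ :=
  (((List.finRange (n + 1)).take k).map fun i => ((g i : Quaternion ℝ)) ^ 2).prod

/-- The ordered full product `g₀² g₁² ⋯ gₙ²`, i.e. `□ₙ(g₀,…,gₙ)`. -/
def fullProd {n : ℕ} (g : Fin (n + 1) → S3) : Quaternion ℝ :=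
  ((List.finRange (n + 1)).map fun i => ((g i : Quaternion ℝ)) ^ 2).prod

/-- The differential of `□ₙ` at `(g₀,…,gₙ)` in the right trivialization:
`L(ξ₀,…,ξₙ) = Σ_k c_k · (ξ_k + g_k ξ_k g_k⁻¹) · c_k⁻¹`. -/
def Lmap {n : ℕ} (g : Fin (n + 1) → S3) (ξ : Fin (n + 1) → Quaternion ℝ) : Quaternion ℝ :=
  ∑ k : Fin (n + 1),
    partialProd g k * (ξ k + (g k : Quaternion ℝ) * ξ k * (g k : Quaternion ℝ)⁻¹) *
      (partialProd g k)⁻¹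

theorem S3.ne_zero (a : S3) : (a : Quaternion ℝ) ≠ 0 :=
  ne_zero_of_mem_unit_sphere a

theorem Quaternion.re_mul_comm (a b : Quaternion ℝ) : (a * b).re = (b * a).re := by
  simp only [Quaternion.re_mul]
  ring

theorem Quaternion.re_conj {c : Quaternion ℝ} (hc : c ≠ 0) (x : Quaternion ℝ) :
    (c * x * c⁻¹).re = x.re := by
  rw [Quaternion.re_mul_comm, inv_mul_cancel_left₀ hc]

/-- A unit quaternion with vanishing real part squares to `-1`. -/
theorem S3.sq_eq_neg_one {a : S3} (ha : (a : Quaternion ℝ).re = 0) :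
    (a : Quaternion ℝ) ^ 2 = -1 := by
  have hn : ‖(a : Quaternion ℝ)‖ = 1 := by simp
  have hstar : star (a : Quaternion ℝ) = -a := by ext <;> simp [ha]
  have h := Quaternion.self_mul_star (a : Quaternion ℝ)
  rw [hstar, Quaternion.normSq_eq_norm_mul_self, hn] at h
  simp only [mul_neg, mul_one, Quaternion.coe_one] at h
  rw [sq, ← h, neg_neg]

/-- If `a` has nonzero real part, `ξ ↦ ξ + a ξ a⁻¹` maps the purely imaginary quaternions onto
themselves. -/
theorem Quaternion.exists_add_conj_eq {a y : Quaternion ℝ} (ha : a.re ≠ 0) (hy : y.re = 0) :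
    ∃ ξ : Quaternion ℝ, ξ.re = 0 ∧ ξ + a * ξ * a⁻¹ = y := by
  have ha0 : a ≠ 0 := by
    rintro rfl
    exact ha rfl
  refine ⟨(2 * a.re)⁻¹ • (y * a).im, by simp, ?_⟩
  apply mul_right_cancel₀ ha0
  rw [add_mul, inv_mul_cancel_right₀ ha0]
  ext <;> simp [hy] <;> field_simp <;> ring

/-- A quaternion commuting with every purely imaginary quaternion is real, so its square is not
`-1`. -/
theorem Quaternion.sq_ne_neg_one_of_commute {a : Quaternion ℝ}
    (h : ∀ y : Quaternion ℝ, y.re = 0 → Commute a y) : a ^ 2 ≠ -1 := by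
  intro hsq
  have hcomm (y : Quaternion ℝ) (hy : y.re = 0) :
      a.imI * y.imJ = a.imJ * y.imI ∧ a.imI * y.imK = a.imK * y.imI := by
    have hJ := congrArg QuaternionAlgebra.imJ (h y hy).eq
    have hK := congrArg QuaternionAlgebra.imK (h y hy).eq
    rw [Quaternion.imJ_mul, Quaternion.imJ_mul] at hJ
    rw [Quaternion.imK_mul, Quaternion.imK_mul] at hK
    constructor <;> linarith
  obtain ⟨hJ, hK⟩ := hcomm ⟨0, 1, 0, 0⟩ rfl
  have hI := (hcomm ⟨0, 0, 1, 0⟩ rfl).1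
  have hre := congrArg QuaternionAlgebra.re hsq
  simp only [mul_zero, mul_one] at hJ hK hI
  simp [sq] at hre
  simp only [hI, ← hJ, ← hK] at hre
  nlinarith [mul_self_nonneg a.re]

theorem partialProd_ne_zero {n : ℕ} (g : Fin (n + 1) → S3) (k : Fin (n + 1)) :
    partialProd g k ≠ 0 := by
  refine List.prod_ne_zero fun h => ?_
  obtain ⟨i, -, hi⟩ := List.mem_map.1 h
  exact pow_ne_zero 2 (S3.ne_zero _) hi

theorem re_Lmap_eq_zero {n : ℕ} (g : Fin (n + 1) → S3) {ξ : Fin (n + 1) → Quaternion ℝ}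
    (hξ : ∀ k, (ξ k).re = 0) : (Lmap g ξ).re = 0 := by
  have hsum : (Lmap g ξ).re = ∑ k, (partialProd g k *
      (ξ k + (g k : Quaternion ℝ) * ξ k * (g k : Quaternion ℝ)⁻¹) * (partialProd g k)⁻¹).re :=
    map_sum (QuaternionAlgebra.reₗ (-1 : ℝ) 0 (-1)) _ _
  rw [hsum]
  refine Finset.sum_eq_zero fun k _ => ?_
  rw [Quaternion.re_conj (partialProd_ne_zero g k), Quaternion.re_add,
    Quaternion.re_conj (S3.ne_zero _), hξ, add_zero]

theorem Lmap_single {n : ℕ} (g : Fin (n + 1) → S3) (k : Fin (n + 1)) (x : Quaternion ℝ) :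
    Lmap g (Pi.single k x) =
      partialProd g k * (x + (g k : Quaternion ℝ) * x * (g k : Quaternion ℝ)⁻¹) *
        (partialProd g k)⁻¹ := by
  rw [Lmap, Finset.sum_eq_single k]
  · simp
  · intro i _ hi
    simp [hi]
  · simp

theorem fullProd_eq_of_re_eq_zero {n : ℕ} {g : Fin (n + 1) → S3}
    (hg : ∀ k, (g k : Quaternion ℝ).re = 0) : fullProd g = (-1) ^ (n + 1) := by
  simp [fullProd, fun k => S3.sq_eq_neg_one (hg k)]

theorem Lmap_image_of_re_ne_zero {n : ℕ} {g : Fin (n + 1) → S3} {k : Fin (n + 1)}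
    (hk : (g k : Quaternion ℝ).re ≠ 0) :
    Lmap g '' {ξ | ∀ k, (ξ k).re = 0} = {y : Quaternion ℝ | y.re = 0} := by
  refine Set.Subset.antisymm ?_ fun y hy => ?_
  · rintro _ ⟨ξ, hξ, rfl⟩
    exact re_Lmap_eq_zero g hξ
  have hc := partialProd_ne_zero g k
  obtain ⟨x, hx, hxy⟩ := Quaternion.exists_add_conj_eq (y := (partialProd g k)⁻¹ * y *
    partialProd g k) hk (by rw [Quaternion.re_mul_comm, mul_inv_cancel_left₀ hc]; exact hy)
  refine ⟨Pi.single k x, fun i => ?_, ?_⟩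
  · obtain rfl | hi := eq_or_ne i k
    · simpa using hx
    · simp only [Pi.single_eq_of_ne hi, Quaternion.re_zero]
  · rw [Lmap_single, hxy, mul_assoc, mul_inv_cancel_right₀ hc, mul_inv_cancel_left₀ hc]

theorem commute_Lmap_const {n : ℕ} {j : S3} (hj : (j : Quaternion ℝ) ^ 2 = -1)
    (ξ : Fin (n + 1) → Quaternion ℝ) :
    Commute (j : Quaternion ℝ) (Lmap (fun _ : Fin (n + 1) => j) ξ) := by
  have hinv : (j : Quaternion ℝ)⁻¹ = -j := by
    refine inv_eq_of_mul_eq_one_right ?_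
    rw [mul_neg, ← sq, hj, neg_neg]
  refine Commute.sum_right _ _ _ fun k _ => ?_
  have hc : Commute (j : Quaternion ℝ) (partialProd (fun _ : Fin (n + 1) => j) k) := by
    refine Commute.list_prod_right _ _ fun x hx => ?_
    obtain ⟨i, -, rfl⟩ := List.mem_map.1 hx
    exact (Commute.refl _).pow_right 2
  refine (hc.mul_right ?_).mul_right hc.inv_right₀
  have hjj : (j : Quaternion ℝ) * j = -1 := by rw [← sq, hj]
  simp only [Commute, SemiconjBy, hinv, mul_add, add_mul, mul_neg, neg_mul]
  simp only [mul_assoc, hjj]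
  simp only [← mul_assoc, hjj]
  simp [add_comm]

/-- If `g₀²⋯gₙ² ≠ (−1)^{n+1}` then `L` maps the tuples of purely imaginary quaternions onto
the purely imaginary quaternions; moreover for the constant tuple at a unit quaternion `j`
with `j² = −1` this fails.  Hence `(−1)^{n+1}` is the only singular value of `□ₙ`. -/
theorem stmt0 (n : ℕ) (g : Fin (n + 1) → S3) (j : S3) (hj : (j : Quaternion ℝ) ^ 2 = -1) :
    (fullProd g ≠ (-1 : Quaternion ℝ) ^ (n + 1) →
      Lmap g '' {ξ | ∀ k, (ξ k).re = 0} = {y : Quaternion ℝ | y.re = 0}) ∧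
    Lmap (fun _ : Fin (n + 1) => j) '' {ξ | ∀ k, (ξ k).re = 0} ≠
      {y : Quaternion ℝ | y.re = 0} := by
  refine ⟨fun hg => ?_, fun h => ?_⟩
  · obtain ⟨k, hk⟩ : ∃ k, (g k : Quaternion ℝ).re ≠ 0 := by
      by_contra! hre
      exact hg (fullProd_eq_of_re_eq_zero hre)
    exact Lmap_image_of_re_ne_zero hk
  · refine Quaternion.sq_ne_neg_one_of_commute (fun y hy => ?_) hj
    obtain ⟨ξ, -, rfl⟩ := h.ge hy
    exact commute_Lmap_const hj ξ
end
end

section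
/- Let g be a unit quaternion with g ≠ −1, and suppose h ∈ S³ satisfies h² = g. Then {k ∈ S³ : k² = g} = {h, −h}; in particular, the set of square roots of g in S³ has exactly two elements. -/
noncomputable section

/-- A unit quaternion `q` satisfies `q² = 2 Re(q) q - 1`. -/
theorem S3.coe_sq (q : S3) :
    (q : Quaternion ℝ) ^ 2 = (2 * (q : Quaternion ℝ).re) • (q : Quaternion ℝ) - 1 := by
  have hq : Quaternion.normSq (q : Quaternion ℝ) = 1 := by
    rw [Quaternion.normSq_eq_norm_mul_self, norm_eq_of_mem_sphere, mul_one]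
  rw [Quaternion.normSq_def'] at hq
  rw [sq]
  ext <;> simp [Quaternion.re_one, Quaternion.imI_one, Quaternion.imJ_one, Quaternion.imK_one] <;> linarith

/-- Two unit quaternions with the same square, the first having nonzero real part, agree up to
sign. -/
theorem S3.eq_or_eq_neg_of_sq_eq_sq {h k : S3} (hre : (h : Quaternion ℝ).re ≠ 0)
    (hk : k ^ 2 = h ^ 2) : k = h ∨ k = -h := by
  have key : (k : Quaternion ℝ).re • (k : Quaternion ℝ) =
      (h : Quaternion ℝ).re • (h : Quaternion ℝ) := by
    have hsq : (k : Quaternion ℝ) ^ 2 = (h : Quaternion ℝ) ^ 2 := by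
      exact_mod_cast congrArg Subtype.val hk
    rw [S3.coe_sq, S3.coe_sq, sub_left_inj, mul_smul, mul_smul] at hsq
    exact smul_right_injective _ (two_ne_zero (α := ℝ)) hsq
  have hsq_re : (k : Quaternion ℝ).re * (k : Quaternion ℝ).re =
      (h : Quaternion ℝ).re * (h : Quaternion ℝ).re := by
    simpa using congrArg QuaternionAlgebra.re key
  rcases mul_self_eq_mul_self_iff.mp hsq_re with e | e
  · left
    rw [e] at key
    exact Subtype.ext (smul_right_injective _ hre key)
  · right
    rw [e, neg_smul, ← smul_neg] at key
    refine Subtype.ext (neg_eq_iff_eq_neg.mp ?_)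
    exact smul_right_injective _ hre key

/-- If `g ≠ −1` is a unit quaternion and `h² = g`, then the set of square roots of `g`
in `S³` is exactly `{h, −h}`; in particular it has exactly two elements. -/
theorem stmt3 (g h : S3) (hg : g ≠ -1) (hh : h ^ 2 = g) :
    {k : S3 | k ^ 2 = g} = {h, -h} ∧ {k : S3 | k ^ 2 = g}.ncard = 2 := by
  have hre : (h : Quaternion ℝ).re ≠ 0 := by
    intro h0
    refine hg (hh ▸ Subtype.ext ?_)
    have hsq := S3.coe_sq h
    rw [h0, mul_zero, zero_smul, zero_sub] at hsq
    exact hsq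
  have hset : {k : S3 | k ^ 2 = g} = {h, -h} := by
    ext k
    simp only [Set.mem_ofPred_eq, Set.mem_insert_iff, Set.mem_singleton_iff]
    refine ⟨fun hk => S3.eq_or_eq_neg_of_sq_eq_sq hre (hk.trans hh.symm), ?_⟩
    rintro (rfl | rfl)
    · exact hh
    · exact (neg_sq h).trans hh
  refine ⟨hset, hset ▸ Set.ncard_pair fun heq => hre ?_⟩
  have hneg : (h : Quaternion ℝ).re = -(h : Quaternion ℝ).re :=
    congrArg (fun q : S3 => (q : Quaternion ℝ).re) heq
  linarith
end
end

section
/- Fix n ≥ 0. For any two unit quaternions c and c′ with c ≠ (−1)^{n+1} and c′ ≠ (−1)^{n+1}, the spaces Xₙ(c) and Xₙ(c′) are homeomorphic. (All fibres of □ₙ over points other than (−1)^{n+1} are homeomorphic.) -/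
noncomputable section

/-- The map `□ₙ : (S³)^{n+1} → S³`, `(g₀,…,gₙ) ↦ g₀²g₁²⋯gₙ²` (ordered product). -/
def box (n : ℕ) (g : Fin (n + 1) → S3) : S3 :=
  ((List.finRange (n + 1)).map fun i => (g i) ^ 2).prod

/-- The fibre `Xₙ(ε) = □ₙ⁻¹(ε)`, with the subspace topology. -/
abbrev X (n : ℕ) (ε : S3) : Type := {g : Fin (n + 1) → S3 // box n g = ε}

open Set Filter Topology
open scoped Quaternion NNReal

section Flow

variable {E : Type*} [NormedAddCommGroup E] [NormedSpace ℝ E]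

/-- `y` is reached from `x` by following the vector field `V` for time `1`. -/
def FlowsTo (V : E → E) (x y : E) : Prop :=
  ∃ γ : ℝ → E, γ 0 = x ∧ γ 1 = y ∧
    ∀ t ∈ Icc (0 : ℝ) 1, HasDerivWithinAt γ (V (γ t)) (Icc 0 1) t

lemma FlowsTo.dist_le {V : E → E} {K : ℝ≥0} (hV : LipschitzWith K V) {x y x' y' : E}
    (h : FlowsTo V x y) (h' : FlowsTo V x' y') : dist y y' ≤ dist x x' * Real.exp K := by
  obtain ⟨γ, rfl, rfl, hγ⟩ := h
  obtain ⟨δ, rfl, rfl, hδ⟩ := h'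
  have key : ∀ {f : ℝ → E}, (∀ t ∈ Icc (0 : ℝ) 1, HasDerivWithinAt f (V (f t)) (Icc 0 1) t) →
      ∀ t ∈ Ico (0 : ℝ) 1, HasDerivWithinAt f (V (f t)) (Ici t) t := fun hf t ht =>
    (hf t (Ico_subset_Icc_self ht)).mono_of_mem_nhdsWithin (Icc_mem_nhdsGE_of_mem ht)
  have := dist_le_of_trajectories_ODE (v := fun _ => V) (fun _ => hV)
    (fun t ht => (hγ t ht).continuousWithinAt) (key hγ)
    (fun t ht => (hδ t ht).continuousWithinAt) (key hδ) le_rfl 1 (right_mem_Icc.2 zero_le_one)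
  simpa using this

lemma FlowsTo.neg {V : E → E} {x y : E} (h : FlowsTo V x y) : FlowsTo (fun z => -V z) y x := by
  obtain ⟨γ, rfl, rfl, hγ⟩ := h
  refine ⟨fun t => γ (1 - t), by simp, by simp, fun t ht => ?_⟩
  have hm : MapsTo (fun t : ℝ => 1 - t) (Icc 0 1) (Icc 0 1) := fun s hs =>
    ⟨by linarith [hs.2], by linarith [hs.1]⟩
  have h1 : HasDerivWithinAt (fun t : ℝ => 1 - t) (-1) (Icc 0 1) t := by
    simpa using (hasDerivWithinAt_id t (Icc (0 : ℝ) 1)).const_sub 1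
  simpa [Function.comp_def] using (hγ (1 - t) (hm ht)).scomp t h1 hm

lemma exists_flowsTo [CompleteSpace E] {V : E → E} {K L : ℝ≥0} (hV : LipschitzWith K V)
    (hL : ∀ x, ‖V x‖ ≤ L) (x : E) : ∃ y, FlowsTo V x y := by
  have hp : IsPicardLindelof (fun _ => V) (⟨0, left_mem_Icc.2 zero_le_one⟩ : Icc (0 : ℝ) 1)
      x L 0 L K :=
    { lipschitzOnWith := fun _ _ => hV.lipschitzOnWith
      continuousOn := fun _ _ => continuousOn_const
      norm_le := fun _ _ y _ => hL y
      mul_max_le := by simp }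
  obtain ⟨γ, h0, hγ⟩ := hp.exists_eq_forall_mem_Icc_hasDerivWithinAt₀
  exact ⟨γ 1, γ, h0, rfl, hγ⟩

/-- The time-one flow of a bounded Lipschitz vector field is a homeomorphism. -/
lemma exists_homeomorph_flowsTo [CompleteSpace E] {V : E → E} {K L : ℝ≥0}
    (hV : LipschitzWith K V) (hL : ∀ x, ‖V x‖ ≤ L) :
    ∃ e : E ≃ₜ E, ∀ x, FlowsTo V x (e x) := by
  have hV' : LipschitzWith K (fun z => -V z) := hV.neg
  choose f hf using exists_flowsTo hV hL
  choose g hg using exists_flowsTo hV' (L := L) (fun x => by simpa using hL x)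
  have hcont : ∀ {W : E → E} (_ : LipschitzWith K W) {f : E → E} (_ : ∀ x, FlowsTo W x (f x)),
      Continuous f := fun hW f hf => by
    refine (LipschitzWith.of_dist_le_mul (K := ⟨Real.exp K, (Real.exp_pos _).le⟩)
      fun x y => ?_).continuous
    rw [mul_comm]
    exact (hf x).dist_le hW (hf y)
  refine ⟨⟨⟨f, g, fun x => ?_, fun x => ?_⟩, hcont hV hf, hcont hV' hg⟩, hf⟩
  · simpa using (hg (f x)).dist_le hV' (hf x).neg
  · have h := (hg x).neg
    simp only [neg_neg] at h
    simpa using (hf (g x)).dist_le hV h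

end Flow

section Field

variable {m : ℕ}

/-- The ordered product of the squares of the coordinates indexed by a list. -/
def sqProd (l : List (Fin m)) (g : Fin m → ℍ[ℝ]) : ℍ[ℝ] := (l.map fun i => g i ^ 2).prod

/-- The sum of the squares of the real parts of the coordinates indexed by a list. -/
def reSqSum (l : List (Fin m)) (g : Fin m → ℍ[ℝ]) : ℝ := (l.map fun i => (g i).re ^ 2).sum

/-- The conjugate of `ξ` by the product of the squares of the coordinates after the `i`-th. -/
def tailConj (ξ : ℍ[ℝ]) (g : Fin m → ℍ[ℝ]) (i : Fin m) : ℍ[ℝ] :=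
  sqProd ((List.finRange m).drop (i + 1)) g * ξ *
    star (sqProd ((List.finRange m).drop (i + 1)) g)

/-- A polynomial vector field, tangent to the product of unit spheres, along which the product
`p` of all squares moves with velocity proportional to `p * ξ`. -/
def pushField (ξ : ℍ[ℝ]) (g : Fin m → ℍ[ℝ]) (i : Fin m) : ℍ[ℝ] :=
  ((g i).re / 4) • (g i * (g i * tailConj ξ g i + tailConj ξ g i * star (g i)))

lemma pushField_neg (ξ : ℍ[ℝ]) (g : Fin m → ℍ[ℝ]) : pushField (-ξ) g = -pushField ξ g := by
  funext i
  simp only [pushField, tailConj, Pi.neg_apply, mul_neg, neg_mul, ← smul_neg]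
  congr 1
  noncomm_ring

lemma contDiff_sqProd (l : List (Fin m)) : ContDiff ℝ 1 (sqProd l) := by
  induction l with
  | nil => exact contDiff_const
  | cons i l ih =>
    have : sqProd (i :: l) = fun g => g i ^ 2 * sqProd l g := by
      funext g; simp [sqProd]
    rw [this]
    fun_prop

lemma contDiff_quaternion_re : ContDiff ℝ 1 (fun q : ℍ[ℝ] => q.re) :=
  (LinearMap.toContinuousLinearMap
    (⟨⟨fun q : ℍ[ℝ] => q.re, fun _ _ => rfl⟩, fun _ _ => rfl⟩ : ℍ[ℝ] →ₗ[ℝ] ℝ)).contDiff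

/-- Quaternionic conjugation as a continuous linear map. -/
def quaternionStar : ℍ[ℝ] →L[ℝ] ℍ[ℝ] :=
  LinearMap.toContinuousLinearMap
    ⟨⟨fun q : ℍ[ℝ] => star q, star_add⟩, fun r q => Quaternion.star_smul r q⟩

lemma contDiff_quaternion_star : ContDiff ℝ 1 (fun q : ℍ[ℝ] => star q) :=
  quaternionStar.contDiff

lemma contDiff_reSqSum (l : List (Fin m)) : ContDiff ℝ 1 (reSqSum l) := by
  induction l with
  | nil => exact contDiff_const
  | cons i l ih =>
    have : reSqSum (i :: l) = fun g => (g i).re ^ 2 + reSqSum l g := by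
      funext g; simp [reSqSum]
    rw [this]
    exact ((contDiff_quaternion_re.comp (contDiff_apply ℝ ℍ[ℝ] i)).pow 2).add ih

lemma contDiff_pushField (ξ : ℍ[ℝ]) : ContDiff ℝ 1 (pushField (m := m) ξ) := by
  refine contDiff_pi.2 fun i => ?_
  have hi : ContDiff ℝ 1 (fun g : Fin m → ℍ[ℝ] => g i) := contDiff_apply ℝ ℍ[ℝ] i
  have hP := contDiff_sqProd ((List.finRange m).drop (i + 1))
  have hζ : ContDiff ℝ 1 (fun g : Fin m → ℍ[ℝ] => tailConj ξ g i) :=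
    (hP.mul contDiff_const).mul (contDiff_quaternion_star.comp hP)
  exact ((contDiff_quaternion_re.comp hi).div_const 4).smul
    (hi.mul ((hi.mul hζ).add (hζ.mul (contDiff_quaternion_star.comp hi))))

lemma mul_star_self_of_norm_eq_one {q : ℍ[ℝ]} (hq : ‖q‖ = 1) : q * star q = 1 := by
  rw [Quaternion.self_mul_star, Quaternion.normSq_eq_norm_mul_self, hq]; simp

lemma star_mul_self_of_norm_eq_one {q : ℍ[ℝ]} (hq : ‖q‖ = 1) : star q * q = 1 := by
  rw [Quaternion.star_mul_self, Quaternion.normSq_eq_norm_mul_self, hq]; simp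

lemma norm_sqProd {g : Fin m → ℍ[ℝ]} (hg : ∀ i, ‖g i‖ = 1) (l : List (Fin m)) :
    ‖sqProd l g‖ = 1 := by
  induction l with
  | nil => simp [sqProd]
  | cons i l ih => simpa [sqProd, hg] using ih

/-- The identity `g η g + g² η = (re g)² g² ζ` for `η = re g (g ζ + ζ g*) / 4`. -/
lemma deriv_sq_identity {g : ℍ[ℝ]} (hg : ‖g‖ = 1) (ζ : ℍ[ℝ]) :
    (g * (g * ζ + ζ * star g)) * g + g * (g * (g * ζ + ζ * star g)) =
      (4 * g.re) • (g ^ 2 * ζ) := by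
  have h1 := star_mul_self_of_norm_eq_one hg
  have h2 := mul_star_self_of_norm_eq_one hg
  have h3 : g + star g = ((2 * g.re : ℝ) : ℍ[ℝ]) := by
    rw [Quaternion.self_add_star]; push_cast; rfl
  have h4 : (4 * g.re) • (g ^ 2 * ζ) = g ^ 2 * ((g + star g) * ζ) + g ^ 2 * (ζ * (g + star g)) := by
    rw [h3, Quaternion.coe_mul_eq_smul, Quaternion.mul_coe_eq_smul, mul_smul_comm, ← add_smul]
    ring_nf
  rw [h4]
  have h5 : g ^ 2 * (star g * ζ) = g * ζ := by
    rw [pow_two, mul_assoc, ← mul_assoc g (star g), h2, one_mul]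
  have h6 : g * (ζ * star g) * g = g * ζ := by
    rw [mul_assoc, mul_assoc, h1, mul_one]
  simp only [mul_add, add_mul, h5, h6]
  noncomm_ring

lemma hasDerivWithinAt_sqProd_drop {ξ : ℍ[ℝ]} {γ : ℝ → Fin m → ℍ[ℝ]} {b : ℝ} {s : Set ℝ} {t : ℝ}
    (hγ : HasDerivWithinAt γ (b • pushField ξ (γ t)) s t) (h1 : ∀ i, ‖γ t i‖ = 1)
    {k : ℕ} (hk : k ≤ m) :
    HasDerivWithinAt (fun u => sqProd ((List.finRange m).drop k) (γ u))
      ((b * reSqSum ((List.finRange m).drop k) (γ t)) •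
        (sqProd ((List.finRange m).drop k) (γ t) * ξ)) s t := by
  induction hk using Nat.decreasingInduction with
  | self =>
    have hd : (List.finRange m).drop m = [] := by simp
    rw [hd]
    simpa [sqProd, reSqSum] using hasDerivWithinAt_const t s (1 : ℍ[ℝ])
  | of_succ k hk ih =>
    have hd : (List.finRange m).drop k = ⟨k, hk⟩ :: (List.finRange m).drop (k + 1) := by
      rw [List.drop_eq_getElem_cons (by simpa using hk)]
      simp
    set i : Fin m := ⟨k, hk⟩
    set P := sqProd ((List.finRange m).drop (k + 1)) (γ t) with hP
    have hPn : star P * P = 1 := star_mul_self_of_norm_eq_one (norm_sqProd h1 _)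
    have hi := hasDerivWithinAt_pi.1 hγ i
    have hmul := ((hi.mul hi).mul ih)
    rw [hd]
    have e1 : (fun u => sqProd (i :: (List.finRange m).drop (k + 1)) (γ u)) =
        fun u => γ u i * γ u i * sqProd ((List.finRange m).drop (k + 1)) (γ u) := by
      funext u; simp [sqProd, pow_two]
    rw [e1]
    refine hmul.congr_deriv ?_
    symm
    change _ = _ + γ t i * γ t i * _
    have e2 : sqProd (i :: (List.finRange m).drop (k + 1)) (γ t) = γ t i ^ 2 * P := by
      simp [sqProd, P]
    have e3 : reSqSum (i :: (List.finRange m).drop (k + 1)) (γ t) =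
        (γ t i).re ^ 2 + reSqSum ((List.finRange m).drop (k + 1)) (γ t) := by
      simp [reSqSum]
    have e4 : tailConj ξ (γ t) i * P = P * ξ := by
      change P * ξ * star P * P = _
      rw [mul_assoc, hPn, mul_one]
    have e5 := deriv_sq_identity (h1 i) (tailConj ξ (γ t) i)
    rw [e2, e3]
    have e6 : (b • pushField ξ (γ t)) i * γ t i + γ t i * (b • pushField ξ (γ t)) i =
        (b * (γ t i).re ^ 2) • (γ t i ^ 2 * tailConj ξ (γ t) i) := by
      simp only [Pi.smul_apply, pushField, smul_mul_assoc, mul_smul_comm, ← smul_add, e5, smul_smul]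
      congr 1
      ring
    rw [e6, ← hP, smul_mul_assoc, mul_assoc (γ t i ^ 2) (tailConj _ _ _), e4, mul_smul_comm,
      mul_add, add_smul, ← pow_two, mul_assoc]

end Field

section Cutoff

variable {m : ℕ}

lemma contDiff_smoothTransition_div {s₀ : ℝ} (hs : 0 < s₀) :
    ContDiff ℝ 1 (fun s : ℝ => Real.smoothTransition (2 * s / s₀ - 1) / s) := by
  refine contDiff_iff_contDiffAt.2 fun s => ?_
  rcases lt_or_ge (s₀ / 4) s with h | h
  · have h1 : ContDiff ℝ 1 (fun s : ℝ => Real.smoothTransition (2 * s / s₀ - 1)) :=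
      Real.smoothTransition.contDiff.comp (by fun_prop)
    exact h1.contDiffAt.div contDiffAt_id (show s ≠ 0 by intro h; linarith)
  · refine (contDiffAt_const (c := (0 : ℝ))).congr_of_eventuallyEq ?_
    filter_upwards [Iio_mem_nhds (show s < s₀ / 2 by linarith)] with u hu
    have : 2 * u / s₀ - 1 ≤ 0 := by
      rw [sub_nonpos, div_le_one hs]
      linarith [mem_Iio.1 hu]
    rw [Real.smoothTransition.zero_of_nonpos this, zero_div]

/-- A compactly supported smooth substitute for `1 / reSqSum` on the product of unit spheres. -/
lemma exists_cutoff {s₀ : ℝ} (hs : 0 < s₀) :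
    ∃ β : (Fin m → ℍ[ℝ]) → ℝ, ContDiff ℝ 1 β ∧ HasCompactSupport β ∧
      ∀ g : Fin m → ℍ[ℝ], (∀ i, ‖g i‖ = 1) →
        |β g * reSqSum (List.finRange m) g| ≤ 1 ∧
          (s₀ ≤ reSqSum (List.finRange m) g → β g * reSqSum (List.finRange m) g = 1) := by
  let φ : ContDiffBump (0 : Fin m → ℍ[ℝ]) := ⟨1, 2, one_pos, one_lt_two⟩
  refine ⟨fun g => φ g * (Real.smoothTransition (2 * reSqSum (List.finRange m) g / s₀ - 1) /
    reSqSum (List.finRange m) g), ?_, φ.hasCompactSupport.mul_right, fun g hg => ?_⟩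
  · exact φ.contDiff.mul ((contDiff_smoothTransition_div hs).comp (contDiff_reSqSum _))
  · have h1 : φ g = 1 := φ.one_of_mem_closedBall (by
      rw [mem_closedBall_zero_iff]
      exact (pi_norm_le_iff_of_nonneg zero_le_one).2 fun i => (hg i).le)
    simp only [h1, one_mul]
    constructor
    · rcases eq_or_ne (reSqSum (List.finRange m) g) 0 with h0 | h0
      · simp [h0]
      · rw [div_mul_cancel₀ _ h0, abs_of_nonneg (Real.smoothTransition.nonneg _)]
        exact Real.smoothTransition.le_one _
    · intro h
      rw [div_mul_cancel₀ _ (by linarith)]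
      refine Real.smoothTransition.one_of_one_le ?_
      rw [le_sub_iff_add_le, le_div_iff₀ hs]
      linarith

end Cutoff

section Integration

variable {m : ℕ}

lemma norm_eq_one_of_flow {ξ : ℍ[ℝ]} (hξ : star ξ = -ξ) {β : (Fin m → ℍ[ℝ]) → ℝ}
    {γ : ℝ → Fin m → ℍ[ℝ]}
    (hγ : ∀ t ∈ Icc (0 : ℝ) 1, HasDerivWithinAt γ (β (γ t) • pushField ξ (γ t)) (Icc 0 1) t)
    (h0 : ∀ i, ‖γ 0 i‖ = 1) {t : ℝ} (ht : t ∈ Icc (0 : ℝ) 1) (i : Fin m) : ‖γ t i‖ = 1 := by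
  have hd : ∀ t ∈ Icc (0 : ℝ) 1,
      HasDerivWithinAt (fun u => γ u i * star (γ u i)) 0 (Icc 0 1) t := fun t ht => by
    have hi := hasDerivWithinAt_pi.1 (hγ t ht) i
    have hstar : HasDerivWithinAt (fun u => star (γ u i))
        (star ((β (γ t) • pushField ξ (γ t)) i)) (Icc 0 1) t :=
      quaternionStar.hasFDerivAt.comp_hasDerivWithinAt t hi
    refine (hi.mul hstar).congr_deriv ?_
    have hζ : star (tailConj ξ (γ t) i) = -tailConj ξ (γ t) i := by
      simp [tailConj, hξ, mul_assoc]
    simp only [Pi.smul_apply, pushField, Quaternion.star_smul, star_mul, star_add, hζ, star_star,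
      smul_mul_assoc, mul_smul_comm, ← smul_add]
    simp only [smul_eq_zero]
    right; right
    noncomm_ring
  have hc := norm_image_sub_le_of_norm_deriv_le_segment' hd (C := 0) (by simp) t ht
  rw [zero_mul, norm_le_zero_iff, sub_eq_zero, Quaternion.self_mul_star, Quaternion.self_mul_star,
    Quaternion.coe_inj, Quaternion.normSq_eq_norm_mul_self, Quaternion.normSq_eq_norm_mul_self,
    h0 i, mul_one] at hc
  nlinarith [norm_nonneg (γ t i)]

lemma exp_neg_mul_exp (ξ : ℍ[ℝ]) : NormedSpace.exp (-ξ) * NormedSpace.exp ξ = 1 := by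
  let _ : NormedAlgebra ℚ ℍ[ℝ] := NormedAlgebra.restrictScalars ℚ ℝ ℍ[ℝ]
  rw [← NormedSpace.exp_add_of_commute (Commute.neg_left (Commute.refl ξ)), neg_add_cancel,
    NormedSpace.exp_zero]

lemma eq_mul_exp_of_deriv {p : ℝ → ℍ[ℝ]} {ξ : ℍ[ℝ]}
    (hp : ∀ t ∈ Icc (0 : ℝ) 1, HasDerivWithinAt p (p t * ξ) (Icc 0 1) t) :
    p 1 = p 0 * NormedSpace.exp ξ := by
  have hd : ∀ t ∈ Icc (0 : ℝ) 1,
      HasDerivWithinAt (fun u => p u * NormedSpace.exp (u • (-ξ))) 0 (Icc 0 1) t := fun t ht => by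
    refine ((hp t ht).mul (hasDerivAt_exp_smul_const' (-ξ) t).hasDerivWithinAt).congr_deriv ?_
    noncomm_ring
  have hc := norm_image_sub_le_of_norm_deriv_le_segment' hd (C := 0) (by simp) 1
    (right_mem_Icc.2 zero_le_one)
  rw [zero_mul, norm_le_zero_iff, sub_eq_zero] at hc
  simp only [one_smul, zero_smul, NormedSpace.exp_zero, mul_one] at hc
  rw [← hc, mul_assoc, exp_neg_mul_exp, mul_one]

lemma FlowsTo.sqProd_eq {ξ c₀ : ℍ[ℝ]} (hξ : star ξ = -ξ) {β : (Fin m → ℍ[ℝ]) → ℝ} {s₀ r : ℝ}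
    (hβ : ∀ g : Fin m → ℍ[ℝ], (∀ i, ‖g i‖ = 1) →
      |β g * reSqSum (List.finRange m) g| ≤ 1 ∧
        (s₀ ≤ reSqSum (List.finRange m) g → β g * reSqSum (List.finRange m) g = 1))
    (hs : ∀ g : Fin m → ℍ[ℝ], (∀ i, ‖g i‖ = 1) → ‖sqProd (List.finRange m) g - c₀‖ ≤ r →
      s₀ ≤ reSqSum (List.finRange m) g)
    {x y : Fin m → ℍ[ℝ]} (h : FlowsTo (fun g => β g • pushField ξ g) x y)
    (hx : ∀ i, ‖x i‖ = 1) (hr : ‖sqProd (List.finRange m) x - c₀‖ + ‖ξ‖ ≤ r) :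
    (∀ i, ‖y i‖ = 1) ∧
      sqProd (List.finRange m) y = sqProd (List.finRange m) x * NormedSpace.exp ξ := by
  obtain ⟨γ, rfl, rfl, hγ⟩ := h
  have hn : ∀ t ∈ Icc (0 : ℝ) 1, ∀ i, ‖γ t i‖ = 1 := fun t ht i =>
    norm_eq_one_of_flow hξ hγ hx ht i
  have hd : ∀ t ∈ Icc (0 : ℝ) 1, HasDerivWithinAt (fun u => sqProd (List.finRange m) (γ u))
      ((β (γ t) * reSqSum (List.finRange m) (γ t)) • (sqProd (List.finRange m) (γ t) * ξ))
      (Icc 0 1) t := fun t ht => by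
    simpa using hasDerivWithinAt_sqProd_drop (hγ t ht) (hn t ht) (Nat.zero_le m)
  have hclose := norm_image_sub_le_of_norm_deriv_le_segment' hd (C := ‖ξ‖) fun t ht => by
    have ht' := Ico_subset_Icc_self ht
    rw [norm_smul, norm_mul (sqProd _ _), norm_sqProd (hn t ht'), one_mul, Real.norm_eq_abs]
    exact mul_le_of_le_one_left (norm_nonneg _) (hβ _ (hn t ht')).1
  refine ⟨hn 1 (right_mem_Icc.2 zero_le_one),
    eq_mul_exp_of_deriv (p := fun u => sqProd (List.finRange m) (γ u)) fun t ht => ?_⟩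
  have hball : ‖sqProd (List.finRange m) (γ t) - c₀‖ ≤ r := by
    have h1 := hclose t ht
    have h2 : ‖ξ‖ * (t - 0) ≤ ‖ξ‖ :=
      mul_le_of_le_one_right (norm_nonneg _) (by linarith [ht.2])
    have h3 := norm_sub_le_norm_sub_add_norm_sub (sqProd (List.finRange m) (γ t))
      (sqProd (List.finRange m) (γ 0)) c₀
    linarith
  have h1 := (hβ _ (hn t ht)).2 (hs _ (hn t ht) hball)
  simpa only [h1, one_smul] using hd t ht

end Integration

section Fibres

variable {m : ℕ}

lemma reSqSum_nonneg (l : List (Fin m)) (g : Fin m → ℍ[ℝ]) : 0 ≤ reSqSum l g :=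
  List.sum_nonneg (by simp only [List.mem_map]; rintro _ ⟨i, -, rfl⟩; positivity)

lemma sqProd_eq_of_reSqSum_eq_zero {g : Fin m → ℍ[ℝ]} (hg : ∀ i, ‖g i‖ = 1) (l : List (Fin m))
    (h : reSqSum l g = 0) : sqProd l g = (-1) ^ l.length := by
  induction l with
  | nil => simp [sqProd]
  | cons i l ih =>
    have hsum : (g i).re ^ 2 + reSqSum l g = 0 := by simpa [reSqSum] using h
    have hl : reSqSum l g = 0 := by nlinarith [reSqSum_nonneg l g, sq_nonneg (g i).re]
    have hre : (g i).re = 0 := by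
      rw [hl, add_zero] at hsum
      exact pow_eq_zero_iff two_ne_zero |>.1 hsum
    have hsq : g i ^ 2 = -1 := by
      rw [Quaternion.sq_eq_neg_normSq.2 hre, Quaternion.normSq_eq_norm_mul_self, hg i]
      simp
    have : sqProd (i :: l) g = g i ^ 2 * sqProd l g := by simp [sqProd]
    rw [this, ih hl, hsq, List.length_cons, pow_succ']

/-- Away from the critical value `(-1) ^ m`, the sum of squares of real parts is bounded below. -/
lemma exists_lower_bound_reSqSum {c₀ : ℍ[ℝ]} (hc : c₀ ≠ (-1) ^ m) :
    ∃ r > 0, ∃ s₀ > 0, ∀ g : Fin m → ℍ[ℝ], (∀ i, ‖g i‖ = 1) →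
      ‖sqProd (List.finRange m) g - c₀‖ ≤ r → s₀ ≤ reSqSum (List.finRange m) g := by
  have hpos : 0 < ‖(-1) ^ m - c₀‖ := norm_pos_iff.2 (sub_ne_zero.2 hc.symm)
  refine ⟨‖(-1) ^ m - c₀‖ / 2, half_pos hpos, ?_⟩
  let K : Set (Fin m → ℍ[ℝ]) :=
    {g | (∀ i, ‖g i‖ = 1) ∧ ‖sqProd (List.finRange m) g - c₀‖ ≤ ‖(-1) ^ m - c₀‖ / 2}
  have hP := (contDiff_sqProd (List.finRange m)).continuous
  have hK : IsCompact K := by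
    refine (isCompact_closedBall (0 : Fin m → ℍ[ℝ]) 1).of_isClosed_subset ?_ fun g hg => ?_
    · refine IsClosed.inter ?_ (isClosed_le (hP.sub continuous_const).norm continuous_const)
      have hset : {g : Fin m → ℍ[ℝ] | ∀ i, ‖g i‖ = 1} = ⋂ i, {g | ‖g i‖ = 1} := by ext; simp
      change IsClosed {g : Fin m → ℍ[ℝ] | ∀ i, ‖g i‖ = 1}
      rw [hset]
      exact isClosed_iInter fun i => isClosed_eq (by fun_prop) continuous_const
    · rw [mem_closedBall_zero_iff]
      exact (pi_norm_le_iff_of_nonneg zero_le_one).2 fun i => (hg.1 i).le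
  obtain ⟨s₀, hs₀, h⟩ := hK.exists_forall_le' (a := (0 : ℝ))
    (contDiff_reSqSum (List.finRange m)).continuous.continuousOn fun g hg => by
      refine (reSqSum_nonneg _ g).lt_of_ne fun h0 => ?_
      have h1 := hg.2
      rw [sqProd_eq_of_reSqSum_eq_zero hg.1 _ h0.symm, List.length_finRange] at h1
      linarith
  exact ⟨s₀, hs₀, fun g hg hr => h g ⟨hg, hr⟩⟩

lemma exists_homeomorph_sqProd {c₀ : ℍ[ℝ]} (hc : c₀ ≠ (-1) ^ m) :
    ∃ ε > 0, ∀ ξ : ℍ[ℝ], star ξ = -ξ → ‖ξ‖ < ε → ‖c₀ * NormedSpace.exp ξ - c₀‖ < ε →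
      ∃ e : (Fin m → ℍ[ℝ]) ≃ₜ (Fin m → ℍ[ℝ]), ∀ g,
        ((∀ i, ‖g i‖ = 1) ∧ sqProd (List.finRange m) g = c₀) ↔
          ((∀ i, ‖e g i‖ = 1) ∧ sqProd (List.finRange m) (e g) = c₀ * NormedSpace.exp ξ) := by
  obtain ⟨r, hr, s₀, hs₀, hs⟩ := exists_lower_bound_reSqSum hc
  obtain ⟨β, hβ, hβc, hβS⟩ := exists_cutoff (m := m) hs₀
  refine ⟨r / 2, half_pos hr, fun ξ hξ hξr hcr => ?_⟩
  have hV : ContDiff ℝ 1 (fun g => β g • pushField ξ g) := hβ.smul (contDiff_pushField ξ)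
  have hVc : HasCompactSupport (fun g => β g • pushField ξ g) := hβc.smul_right
  obtain ⟨K, hK⟩ := hV.lipschitzWith_of_hasCompactSupport hVc one_ne_zero
  obtain ⟨L, hL⟩ := hVc.exists_bound_of_continuous hV.continuous
  obtain ⟨e, he⟩ := exists_homeomorph_flowsTo hK (L := L.toNNReal)
    fun g => (hL g).trans (Real.le_coe_toNNReal L)
  refine ⟨e, fun g => ⟨fun ⟨h1, h2⟩ => ?_, fun ⟨h1, h2⟩ => ?_⟩⟩
  · have := (he g).sqProd_eq hξ hβS hs h1 (by rw [h2, sub_self, norm_zero]; linarith)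
    rwa [h2] at this
  · have hb := (he g).neg
    simp only [← smul_neg, ← pushField_neg] at hb
    have := hb.sqProd_eq (by rw [star_neg, hξ]) hβS hs h1 (by rw [h2, norm_neg]; linarith)
    have hexp := exp_neg_mul_exp (-ξ)
    rw [neg_neg] at hexp
    rwa [h2, mul_assoc, hexp, mul_one] at this

lemma coe_box (n : ℕ) (g : Fin (n + 1) → S3) :
    (box n g : ℍ[ℝ]) = sqProd (List.finRange (n + 1)) fun i => (g i : ℍ[ℝ]) := by
  unfold box sqProd
  induction List.finRange (n + 1) with
  | nil => simp
  | cons i l ih => simp [ih]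

/-- The fibre of `box n` over `c`, viewed as a space of tuples of quaternions. -/
def homeomorphFibre (n : ℕ) (c : S3) : X n c ≃ₜ
    {g : Fin (n + 1) → ℍ[ℝ] //
      (∀ i, ‖g i‖ = 1) ∧ sqProd (List.finRange (n + 1)) g = (c : ℍ[ℝ])} where
  toFun g := ⟨fun i => g.1 i, fun i => norm_eq_of_mem_sphere _, by rw [← coe_box, g.2]⟩
  invFun g := ⟨fun i => ⟨g.1 i, mem_sphere_zero_iff_norm.2 (g.2.1 i)⟩,
    Subtype.ext (by rw [coe_box]; exact g.2.2)⟩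
  left_inv _ := rfl
  right_inv _ := rfl
  continuous_toFun := Continuous.subtype_mk (continuous_pi fun i =>
    continuous_subtype_val.comp ((continuous_apply i).comp continuous_subtype_val)) _
  continuous_invFun := Continuous.subtype_mk (continuous_pi fun i =>
    Continuous.subtype_mk ((continuous_apply i).comp continuous_subtype_val) _) _

/-- Every unit quaternion close to `1` is the exponential of a small imaginary quaternion. -/
lemma eventually_exists_exp_eq {ε : ℝ} (hε : 0 < ε) :
    ∀ᶠ q : ℍ[ℝ] in 𝓝 1, ‖q‖ = 1 →
      ∃ ξ : ℍ[ℝ], star ξ = -ξ ∧ ‖ξ‖ < ε ∧ NormedSpace.exp ξ = q := by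
  have hmap : map (NormedSpace.exp : ℍ[ℝ] → ℍ[ℝ]) (𝓝 0) = 𝓝 1 := by
    have h : HasStrictFDerivAt (NormedSpace.exp : ℍ[ℝ] → ℍ[ℝ])
        ((ContinuousLinearEquiv.refl ℝ ℍ[ℝ] : ℍ[ℝ] ≃L[ℝ] ℍ[ℝ]) : ℍ[ℝ] →L[ℝ] ℍ[ℝ]) 0 :=
      hasStrictFDerivAt_exp_zero
    simpa using h.map_nhds_eq_of_equiv
  rw [← hmap]
  filter_upwards [image_mem_map (Metric.ball_mem_nhds (0 : ℍ[ℝ]) hε)]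
  rintro _ ⟨ξ, hξ, rfl⟩ hn
  refine ⟨ξ, ?_, mem_ball_zero_iff.1 hξ, rfl⟩
  rw [Quaternion.norm_exp, ← Real.exp_eq_exp_ℝ, Real.norm_eq_abs, Real.abs_exp,
    Real.exp_eq_one_iff] at hn
  exact Quaternion.star_eq_neg.2 hn

lemma eventually_nonempty_homeomorph (n : ℕ) {c : S3} (hc : c ≠ (-1 : S3) ^ (n + 1)) :
    ∀ᶠ c' in 𝓝 c, Nonempty (X n c ≃ₜ X n c') := by
  have hc' : (c : ℍ[ℝ]) ≠ (-1) ^ (n + 1) := fun h =>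
    hc (Subtype.ext (by rw [Metric.unitSphere.coe_pow]; exact h))
  obtain ⟨ε, hε, h⟩ := exists_homeomorph_sqProd hc'
  have hcn : ‖(c : ℍ[ℝ])‖ = 1 := norm_eq_of_mem_sphere c
  have ht : Tendsto (fun c' : S3 => star (c : ℍ[ℝ]) * c') (𝓝 c) (𝓝 1) := by
    rw [← star_mul_self_of_norm_eq_one hcn]
    exact Continuous.tendsto (by fun_prop) c
  have ht' : Tendsto (fun c' : S3 => ‖(c' : ℍ[ℝ]) - c‖) (𝓝 c) (𝓝 0) := by
    have : Continuous (fun c' : S3 => ‖(c' : ℍ[ℝ]) - c‖) := by fun_prop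
    simpa using this.tendsto c
  filter_upwards [ht.eventually (eventually_exists_exp_eq hε), ht'.eventually_lt_const hε]
    with c' h1 h2
  obtain ⟨ξ, hξ, hξε, hexp⟩ := h1 (by simp)
  have hmul : (c : ℍ[ℝ]) * NormedSpace.exp ξ = c' := by
    rw [hexp, ← mul_assoc, mul_star_self_of_norm_eq_one hcn, one_mul]
  obtain ⟨e, he⟩ := h ξ hξ hξε (by rwa [hmul])
  rw [hmul] at he
  exact ⟨(homeomorphFibre n c).trans ((e.subtype he).trans (homeomorphFibre n c').symm)⟩

lemma isPreconnected_compl_singleton_S3 (v : S3) : IsPreconnected ({v}ᶜ : Set S3) := by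
  have hv := norm_eq_of_mem_sphere v
  have h := (stereographic hv).symm_image_target_eq_source
  rw [stereographic_source, stereographic_target] at h
  rw [← h]
  exact isPreconnected_univ.image _
    (by simpa using (stereographic hv).continuousOn_symm)

end Fibres

/-- All fibres of `□ₙ` over points other than `(−1)^{n+1}` are homeomorphic. -/
theorem stmt5 (n : ℕ) (c c' : S3)
    (hc : c ≠ (-1 : S3) ^ (n + 1)) (hc' : c' ≠ (-1 : S3) ^ (n + 1)) :
    Nonempty (X n c ≃ₜ X n c') :=
  (isPreconnected_compl_singleton_S3 ((-1 : S3) ^ (n + 1))).induction₂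
    (fun c c' => Nonempty (X n c ≃ₜ X n c'))
    (fun _ hx => (eventually_nonempty_homeomorph n hx).filter_mono nhdsWithin_le_nhds)
    (fun _ _ _ _ _ _ ⟨e⟩ ⟨f⟩ => ⟨e.trans f⟩) (fun _ _ _ _ ⟨e⟩ => ⟨e.symm⟩) hc hc'
end
end

section
/- Fix n ≥ 0 and let U = S³ ∖ {(−1)^{n+1}}. The map □ₙ restricts to a trivial fibre bundle over U: there exists a homeomorphism Φ : U × Xₙ^r → □ₙ⁻¹(U) such that □ₙ(Φ(c, x)) = c for all c ∈ U and x ∈ Xₙ^r. -/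
noncomputable section

section Bend
variable {V : Type*} [NormedAddCommGroup V]

/-- A cutoff, equal to `1` for `w` near `0` and to `0` for `‖w‖ ≥ 1`. -/
def cutoff (p w : V) : ℝ :=
  max 0 (1 - ‖w‖) / max (2 * (1 + ‖p‖ ^ 2) * ‖w‖) (1 - ‖w‖)

lemma cutoff_denom_pos (p w : V) : 0 < max (2 * (1 + ‖p‖ ^ 2) * ‖w‖) (1 - ‖w‖) := by
  rcases (norm_nonneg w).eq_or_lt with h | h
  · rw [← h]; simp
  · exact lt_max_of_lt_left (by positivity)

lemma continuous_cutoff : Continuous fun q : V × V => cutoff q.1 q.2 := by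
  unfold cutoff
  exact Continuous.div (by fun_prop) (by fun_prop) fun q => (cutoff_denom_pos _ _).ne'

lemma cutoff_eq_one {p w : V} (h : 2 * (1 + ‖p‖ ^ 2) * ‖w‖ ≤ 1 - ‖w‖) : cutoff p w = 1 := by
  have h0 : 0 ≤ 1 - ‖w‖ := le_trans (by positivity) h
  have := cutoff_denom_pos p w
  rw [max_eq_right h] at this
  rw [cutoff, max_eq_right h0, max_eq_right h, div_self this.ne']

lemma cutoff_eq_zero {p w : V} (h : 1 ≤ ‖w‖) : cutoff p w = 0 := by
  rw [cutoff, max_eq_left (by linarith), zero_div]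

variable [InnerProductSpace ℝ V]

def bendDenom (p w : V) : ℝ :=
  1 - 2 * cutoff p w * inner ℝ p w + cutoff p w ^ 2 * ‖p‖ ^ 2 * ‖w‖ ^ 2

/-- In the coordinate `w / ‖w‖ ^ 2`, this is the translation by `-p`, cut off near the origin. -/
def bend (p w : V) : V :=
  (bendDenom p w)⁻¹ • (w - (cutoff p w * ‖w‖ ^ 2) • p)

/-- Inversion in the unit sphere. -/
def unitInversion (x : V) : V := (‖x‖ ^ 2)⁻¹ • x

/-- The translation by `-p`, cut off near the origin. -/
def cutTranslation (p v : V) : V :=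
  v - (max 0 (‖v‖ - 1) / max (2 * (1 + ‖p‖ ^ 2)) (‖v‖ - 1)) • p

lemma bend_eq_self {p w : V} (h : 1 ≤ ‖w‖) : bend p w = w := by
  simp [bend, bendDenom, cutoff_eq_zero h]

lemma norm_unitInversion (x : V) : ‖unitInversion x‖ = ‖x‖⁻¹ := by
  rcases eq_or_ne x 0 with rfl | hx
  · simp [unitInversion]
  · have : ‖x‖ ≠ 0 := norm_ne_zero_iff.2 hx
    rw [unitInversion, norm_smul, norm_inv, norm_pow, norm_norm]
    field_simp

lemma unitInversion_involutive : Function.Involutive (unitInversion (V := V)) := by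
  intro x
  rcases eq_or_ne x 0 with rfl | hx
  · simp [unitInversion]
  · have : ‖x‖ ≠ 0 := norm_ne_zero_iff.2 hx
    rw [unitInversion, norm_unitInversion, unitInversion, smul_smul]
    rw [inv_pow, inv_inv, mul_inv_cancel₀ (by positivity), one_smul]

lemma cutTranslation_factor_eq (a s : ℝ) (ha : 0 < a) :
    max 0 s / max a s = min 1 (max 0 s / a) := by
  rcases le_total a s with h | h
  · have hs : 0 < s := ha.trans_le h
    rw [max_eq_right h, max_eq_right hs.le, div_self hs.ne', min_eq_left]
    rwa [one_le_div ha]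
  · rw [max_eq_left h, min_eq_right]
    rw [div_le_one ha]
    exact max_le ha.le h

lemma cutTranslation_injective (p : V) : Function.Injective (cutTranslation p) := by
  intro v v' h
  have ha : 0 < 2 * (1 + ‖p‖ ^ 2) := by positivity
  simp only [cutTranslation, cutTranslation_factor_eq _ _ ha] at h
  set s := min 1 (max 0 (‖v‖ - 1) / (2 * (1 + ‖p‖ ^ 2))) with hs
  set s' := min 1 (max 0 (‖v'‖ - 1) / (2 * (1 + ‖p‖ ^ 2))) with hs'
  have hd : v - v' = (s - s') • p := by
    rw [sub_smul, sub_eq_sub_iff_add_eq_add, add_comm (s • p)]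
    exact sub_eq_sub_iff_add_eq_add.1 h
  have hle : |s - s'| ≤ ‖v - v'‖ / (2 * (1 + ‖p‖ ^ 2)) := by
    calc |s - s'| ≤ |max 0 (‖v‖ - 1) / (2 * (1 + ‖p‖ ^ 2))
            - max 0 (‖v'‖ - 1) / (2 * (1 + ‖p‖ ^ 2))| := by
          have := abs_min_sub_min_le_max (1 : ℝ) (max 0 (‖v‖ - 1) / (2 * (1 + ‖p‖ ^ 2))) 1
            (max 0 (‖v'‖ - 1) / (2 * (1 + ‖p‖ ^ 2)))
          simpa using this
      _ = |max 0 (‖v‖ - 1) - max 0 (‖v'‖ - 1)| / (2 * (1 + ‖p‖ ^ 2)) := by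
          rw [← sub_div, abs_div, abs_of_pos ha]
      _ ≤ |‖v‖ - ‖v'‖| / (2 * (1 + ‖p‖ ^ 2)) := by
          refine div_le_div_of_nonneg_right ?_ ha.le
          have := abs_max_sub_max_le_max (0 : ℝ) (‖v‖ - 1) 0 (‖v'‖ - 1)
          simpa using this
      _ ≤ _ := by gcongr; exact abs_norm_sub_norm_le v v'
  have hn : ‖v - v'‖ = |s - s'| * ‖p‖ := by rw [hd, norm_smul, Real.norm_eq_abs]
  rw [le_div_iff₀ ha] at hle
  have : ‖v - v'‖ = 0 := by
    nlinarith [norm_nonneg (v - v'), abs_nonneg (s - s'), sq_nonneg (‖p‖ - 1),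
      mul_nonneg (abs_nonneg (s - s')) (sq_nonneg (‖p‖ - 1))]
  exact sub_eq_zero.1 (norm_eq_zero.1 this)

lemma cutTranslation_surjective (p : V) : Function.Surjective (cutTranslation p) := by
  intro y
  have ha : 0 < 2 * (1 + ‖p‖ ^ 2) := by positivity
  let χ : V → ℝ := fun v => min 1 (max 0 (‖v‖ - 1) / (2 * (1 + ‖p‖ ^ 2)))
  have hχ0 : ∀ v, 0 ≤ χ v := fun v => le_min zero_le_one (by positivity)
  have hχ1 : ∀ v, χ v ≤ 1 := fun v => min_le_left _ _
  have hc : Continuous fun s : ℝ => s - χ (y + s • p) := by fun_prop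
  obtain ⟨s, -, hs⟩ := intermediate_value_Icc (zero_le_one (α := ℝ)) hc.continuousOn
    (show (0 : ℝ) ∈ Set.Icc _ _ from
      ⟨by simpa using hχ0 (y + (0 : ℝ) • p), by simpa using hχ1 (y + (1 : ℝ) • p)⟩)
  refine ⟨y + s • p, ?_⟩
  rw [cutTranslation, cutTranslation_factor_eq _ _ ha]
  have hs' : s = χ (y + s • p) := sub_eq_zero.1 hs
  change y + s • p - χ (y + s • p) • p = y
  rw [← hs', add_sub_cancel_right]

lemma cutTranslation_zero (p : V) : cutTranslation p 0 = 0 := by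
  simp [cutTranslation]

lemma cutTranslation_unitInversion (p : V) {w : V} (hw : w ≠ 0) :
    cutTranslation p (unitInversion w) = unitInversion w - cutoff p w • p := by
  have h : 0 < ‖w‖ := norm_pos_iff.2 hw
  rw [cutTranslation, norm_unitInversion, cutoff]
  congr 2
  have h1 : max 0 (1 - ‖w‖) = ‖w‖ * max 0 (‖w‖⁻¹ - 1) := by
    rw [mul_max_of_nonneg _ _ h.le, mul_zero]; congr 1; field_simp
  have h2 : max (2 * (1 + ‖p‖ ^ 2) * ‖w‖) (1 - ‖w‖)
      = ‖w‖ * max (2 * (1 + ‖p‖ ^ 2)) (‖w‖⁻¹ - 1) := by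
    rw [mul_max_of_nonneg _ _ h.le]; congr 1 <;> field_simp
  rw [h1, h2, mul_div_mul_left _ _ h.ne']

lemma bendDenom_eq (p : V) {w : V} (hw : w ≠ 0) :
    bendDenom p w = ‖w‖ ^ 2 * ‖cutTranslation p (unitInversion w)‖ ^ 2 := by
  have h : ‖w‖ ≠ 0 := norm_ne_zero_iff.2 hw
  rw [cutTranslation_unitInversion p hw, norm_sub_sq_real, norm_unitInversion, bendDenom,
    norm_smul, unitInversion, inner_smul_left, inner_smul_right, real_inner_comm w p,
    Real.norm_eq_abs, mul_pow, sq_abs]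
  simp only [map_inv₀, map_pow, conj_trivial]
  field_simp

lemma bendDenom_pos (p w : V) : 0 < bendDenom p w := by
  rcases eq_or_ne w 0 with rfl | hw
  · simp [bendDenom]
  · rw [bendDenom_eq p hw]
    have h : 0 < ‖w‖ := norm_pos_iff.2 hw
    have h2 : cutTranslation p (unitInversion w) ≠ 0 := by
      intro h0
      rw [← cutTranslation_zero p] at h0
      have := congrArg norm (cutTranslation_injective p h0)
      rw [norm_unitInversion, norm_zero, inv_eq_zero] at this
      exact h.ne' this
    have := norm_pos_iff.2 h2
    positivity

lemma bend_eq (p w : V) :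
    bend p w = unitInversion (cutTranslation p (unitInversion w)) := by
  rcases eq_or_ne w 0 with rfl | hw
  · simp [bend, unitInversion, cutTranslation_zero]
  · have h : ‖w‖ ≠ 0 := norm_ne_zero_iff.2 hw
    rw [bend, bendDenom_eq p hw]
    conv_rhs => rw [unitInversion]
    rw [mul_inv, mul_comm, ← smul_smul]
    congr 1
    rw [cutTranslation_unitInversion p hw, smul_sub, smul_smul, unitInversion]
    congr 2
    field_simp

lemma bend_bijective (p : V) : Function.Bijective (bend p) := by
  have : bend p = unitInversion ∘ cutTranslation p ∘ unitInversion := funext (bend_eq p)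
  rw [this]
  exact unitInversion_involutive.bijective.comp
    (Function.Bijective.comp ⟨cutTranslation_injective p, cutTranslation_surjective p⟩
      unitInversion_involutive.bijective)

lemma continuous_bend : Continuous fun q : V × V => bend q.1 q.2 := by
  have := continuous_cutoff (V := V)
  have hd : Continuous fun q : V × V => bendDenom q.1 q.2 := by
    unfold bendDenom; fun_prop
  unfold bend
  exact (hd.inv₀ fun q => (bendDenom_pos _ _).ne').smul (by fun_prop)

end Bend

section Twist
open Quaternion

/-- The radially homogeneous self-map of `ℍ` given by `bend p` on the slice `re = 1`. -/
def homogenizedBend (p x : ℍ[ℝ]) : ℍ[ℝ] :=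
  if x.re = 0 then x else x.re + x.re • bend p (x.re⁻¹ • x.im)

/-- The linear self-map of `ℍ` sending `1` to a positive multiple of `1 + p`. -/
def tilt (p x : ℍ[ℝ]) : ℍ[ℝ] :=
  star (1 + p) * (x.re • (1 + p) + (1 + ‖p‖ ^ 2) • x.im) * (1 + p)

lemma norm_sq_eq_coords (x : ℍ[ℝ]) :
    ‖x‖ ^ 2 = x.re ^ 2 + x.imI ^ 2 + x.imJ ^ 2 + x.imK ^ 2 := by
  rw [← normSq_def', normSq_eq_norm_mul_self, sq]

lemma one_add_ne_zero_of_re_eq_zero {p : ℍ[ℝ]} (hp : p.re = 0) : 1 + p ≠ 0 := by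
  intro h
  have := congrArg (fun q : ℍ[ℝ] => q.re) h
  simp [hp] at this

lemma re_bend {p : ℍ[ℝ]} (hp : p.re = 0) (w : ℍ[ℝ]) :
    (bend p w).re = (bendDenom p w)⁻¹ * w.re := by
  simp [bend, hp]

lemma tilt_bijective {p : ℍ[ℝ]} (hp : p.re = 0) : Function.Bijective (tilt p) := by
  have hb := one_add_ne_zero_of_re_eq_zero hp
  have hs : star (1 + p) ≠ 0 := star_ne_zero.2 hb
  have hl : (1 + ‖p‖ ^ 2 : ℝ) ≠ 0 := by positivity
  constructor
  · intro x y h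
    have h1 := mul_left_cancel₀ hs (mul_right_cancel₀ hb h)
    have hre : x.re = y.re := by
      simpa [hp] using congrArg (fun q : ℍ[ℝ] => q.re) h1
    rw [hre, add_right_inj] at h1
    have him := smul_right_injective _ hl h1
    rw [← re_add_im x, ← re_add_im y, hre, him]
  · intro y
    set z := (star (1 + p))⁻¹ * y * (1 + p)⁻¹ with hz
    refine ⟨z.re + (1 + ‖p‖ ^ 2)⁻¹ • (z - z.re • (1 + p)), ?_⟩
    have h0 : (z - z.re • (1 + p)).re = 0 := by simp [hp]
    have h1 : (z.re + (1 + ‖p‖ ^ 2)⁻¹ • (z - z.re • (1 + p))).re = z.re := by simp [hp]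
    have h2 : (z.re + (1 + ‖p‖ ^ 2)⁻¹ • (z - z.re • (1 + p)) : ℍ[ℝ]).im
        = (1 + ‖p‖ ^ 2)⁻¹ • (z - z.re • (1 + p)) := by
      have := re_add_im (z - z.re • (1 + p))
      rw [h0] at this
      rw [im_add, im_coe, zero_add, im_smul]
      congr 1
      simpa using this
    rw [tilt, h1, h2, smul_smul, mul_inv_cancel₀ hl, one_smul, add_sub_cancel, hz]
    simp only [mul_assoc, inv_mul_cancel₀ hb, mul_one]
    rw [← mul_assoc, mul_inv_cancel₀ hs, one_mul]

lemma re_homogenizedBend {p : ℍ[ℝ]} (hp : p.re = 0) (x : ℍ[ℝ]) :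
    (homogenizedBend p x).re = x.re := by
  unfold homogenizedBend
  split_ifs with h
  · rfl
  · simp [re_bend hp]

lemma homogenizedBend_bijective {p : ℍ[ℝ]} (hp : p.re = 0) :
    Function.Bijective (homogenizedBend p) := by
  constructor
  · intro x y h
    have hre : x.re = y.re := by
      rw [← re_homogenizedBend hp x, h, re_homogenizedBend hp]
    unfold homogenizedBend at h
    rw [← hre] at h
    split_ifs at h with h0
    · exact h
    · have h1 := (bend_bijective p).1 (smul_right_injective _ h0 (add_left_cancel h))
      have him := smul_right_injective _ (inv_ne_zero h0) h1
      rw [← re_add_im x, ← re_add_im y, hre, him]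
  · intro y
    by_cases h0 : y.re = 0
    · exact ⟨y, by simp [homogenizedBend, h0]⟩
    · obtain ⟨w, hw⟩ := (bend_bijective p).2 (y.re⁻¹ • y.im)
      have hwre : w.re = 0 := by
        have := congrArg (fun q : ℍ[ℝ] => q.re) hw
        simpa [re_bend hp, (bendDenom_pos p w).ne'] using this
      have hwim : w.im = w := by
        have := re_add_im w
        rw [hwre] at this
        simpa using this
      refine ⟨y.re + y.re • w, ?_⟩
      have h1 : ((y.re : ℍ[ℝ]) + y.re • w).re = y.re := by simp [hwre]
      have h2 : ((y.re : ℍ[ℝ]) + y.re • w).im = y.re • w := by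
        rw [im_add, im_coe, zero_add, im_smul, hwim]
      rw [homogenizedBend, h1, if_neg h0, h2, smul_smul, inv_mul_cancel₀ h0, one_smul, hw,
        smul_smul, mul_inv_cancel₀ h0, one_smul, re_add_im]

lemma continuousAt_homogenizedBend (p : ℍ[ℝ]) {x : ℍ[ℝ]} (hx : x ≠ 0) :
    ContinuousAt (fun q : ℍ[ℝ] × ℍ[ℝ] => homogenizedBend q.1 q.2) (p, x) := by
  have hre : Continuous fun q : ℍ[ℝ] × ℍ[ℝ] => q.2.re := continuous_re.comp continuous_snd
  have him : Continuous fun q : ℍ[ℝ] × ℍ[ℝ] => q.2.im := continuous_im.comp continuous_snd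
  by_cases h : x.re = 0
  · have hlt : |x.re| < ‖x.im‖ := by
      rw [h, abs_zero, norm_pos_iff]
      intro h'
      apply hx
      rw [← re_add_im x, h, h']
      simp
    have hev : ∀ᶠ q : ℍ[ℝ] × ℍ[ℝ] in nhds (p, x), |q.2.re| < ‖q.2.im‖ :=
      (isOpen_lt hre.abs him.norm).mem_nhds hlt
    refine continuous_snd.continuousAt.congr (hev.mono fun q hq => ?_)
    change q.2 = homogenizedBend q.1 q.2
    unfold homogenizedBend
    split_ifs with h0
    · rfl
    · rw [bend_eq_self, smul_smul, mul_inv_cancel₀ h0, one_smul, re_add_im]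
      rw [norm_smul, norm_inv, Real.norm_eq_abs, ← div_eq_inv_mul, one_le_div (abs_pos.2 h0)]
      exact hq.le
  · have hev : ∀ᶠ q : ℍ[ℝ] × ℍ[ℝ] in nhds (p, x), q.2.re ≠ 0 :=
      (isOpen_ne_fun hre continuous_const).mem_nhds h
    have hc : ContinuousAt (fun q : ℍ[ℝ] × ℍ[ℝ] =>
        (q.2.re : ℍ[ℝ]) + q.2.re • bend q.1 (q.2.re⁻¹ • q.2.im)) (p, x) := by
      have h1 : ContinuousAt (fun q : ℍ[ℝ] × ℍ[ℝ] => (q.1, q.2.re⁻¹ • q.2.im)) (p, x) :=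
        continuous_fst.continuousAt.prodMk ((hre.continuousAt.inv₀ h).smul him.continuousAt)
      have h2 := ContinuousAt.comp (x := (p, x)) continuous_bend.continuousAt h1
      exact (continuous_coe.comp hre).continuousAt.add (hre.continuousAt.smul h2)
    refine hc.congr (hev.mono fun q hq => ?_)
    change _ = homogenizedBend q.1 q.2
    rw [homogenizedBend, if_neg hq]

lemma continuous_tilt : Continuous fun q : ℍ[ℝ] × ℍ[ℝ] => tilt q.1 q.2 := by
  have hre : Continuous fun q : ℍ[ℝ] × ℍ[ℝ] => q.2.re := continuous_re.comp continuous_snd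
  have him : Continuous fun q : ℍ[ℝ] × ℍ[ℝ] => q.2.im := continuous_im.comp continuous_snd
  unfold tilt
  fun_prop

lemma tilt_smul (p : ℍ[ℝ]) (r : ℝ) (x : ℍ[ℝ]) : tilt p (r • x) = r • tilt p x := by
  simp only [tilt, re_smul, im_smul, smul_eq_mul]
  rw [← smul_smul, smul_comm _ r x.im, ← smul_add, mul_smul_comm, smul_mul_assoc]

lemma homogenizedBend_smul (p : ℍ[ℝ]) {r : ℝ} (hr : r ≠ 0) (x : ℍ[ℝ]) :
    homogenizedBend p (r • x) = r • homogenizedBend p x := by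
  unfold homogenizedBend
  by_cases h : x.re = 0
  · simp [h]
  · have h1 : (r * x.re)⁻¹ * r = x.re⁻¹ := by field_simp
    rw [if_neg h, if_neg (by simp [hr, h])]
    simp only [re_smul, im_smul, smul_eq_mul]
    rw [smul_smul, h1, smul_add, smul_smul]
    congr 1
    ext <;> simp

/-- A homogeneous self-homeomorphism of `ℍ` minus the origin. -/
def twist (p x : ℍ[ℝ]) : ℍ[ℝ] := tilt p (homogenizedBend p x)

lemma twist_bijective {p : ℍ[ℝ]} (hp : p.re = 0) : Function.Bijective (twist p) :=
  (tilt_bijective hp).comp (homogenizedBend_bijective hp)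

lemma twist_smul (p : ℍ[ℝ]) {r : ℝ} (hr : r ≠ 0) (x : ℍ[ℝ]) :
    twist p (r • x) = r • twist p x := by
  rw [twist, homogenizedBend_smul p hr, tilt_smul, twist]

lemma twist_zero (p : ℍ[ℝ]) : twist p 0 = 0 := by
  simp [twist, homogenizedBend, tilt]

lemma continuousAt_twist (p : ℍ[ℝ]) {x : ℍ[ℝ]} (hx : x ≠ 0) :
    ContinuousAt (fun q : ℍ[ℝ] × ℍ[ℝ] => twist q.1 q.2) (p, x) :=
  ContinuousAt.comp (f := fun q : ℍ[ℝ] × ℍ[ℝ] => (q.1, homogenizedBend q.1 q.2))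
    (g := fun q : ℍ[ℝ] × ℍ[ℝ] => tilt q.1 q.2) continuous_tilt.continuousAt
    (continuous_fst.continuousAt.prodMk (continuousAt_homogenizedBend p hx))

lemma one_add_mul_sq_mul_one_add {p w : ℍ[ℝ]} (hp : p.re = 0) (hw : w.re = 0) :
    (2 : ℝ) • ((1 - 2 * inner ℝ p w + ‖p‖ ^ 2 * ‖w‖ ^ 2) • (1 + p)
        + (1 + ‖p‖ ^ 2) • (w - ‖w‖ ^ 2 • p))
      = ((1 + ‖p‖ ^ 2) * (1 + ‖w‖ ^ 2)) • 1 + (1 + p) * (1 + w) ^ 2 * (1 + p) := by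
  have hsq : (1 + w) ^ 2 = (1 - ‖w‖ ^ 2) • 1 + (2 : ℝ) • w := by
    rw [norm_sq_eq_coords, hw]
    ext <;> simp [sq, hw] <;> ring
  have hpsq : (1 + p) * (1 + p) = (1 - ‖p‖ ^ 2) • 1 + (2 : ℝ) • p := by
    rw [norm_sq_eq_coords, hp]
    ext <;> simp [hp] <;> ring
  have hpwp : (1 + p) * w * (1 + p)
      = (-2 * inner ℝ p w) • (1 + p) + (1 + ‖p‖ ^ 2) • w := by
    rw [norm_sq_eq_coords, inner_def, hp]
    ext <;> simp [hp, hw] <;> ring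
  rw [hsq, mul_add (1 + p), add_mul _ _ (1 + p), mul_smul_comm, mul_smul_comm, smul_mul_assoc, smul_mul_assoc,
    mul_one, hpsq, hpwp]
  module

lemma star_mul_self_of_re_eq_zero {p : ℍ[ℝ]} (hp : p.re = 0) :
    star (1 + p) * (1 + p) = (1 + ‖p‖ ^ 2) • 1 := by
  rw [norm_sq_eq_coords p]
  ext <;> simp [hp] <;> ring

lemma tilt_polynomial_identity {p w : ℍ[ℝ]} (hp : p.re = 0) (hw : w.re = 0) :
    (2 : ℝ) • (star (1 + p) * ((1 - 2 * inner ℝ p w + ‖p‖ ^ 2 * ‖w‖ ^ 2) • (1 + p)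
        + (1 + ‖p‖ ^ 2) • (w - ‖w‖ ^ 2 • p)) * (1 + p))
      = (1 + ‖p‖ ^ 2) • (((1 + ‖p‖ ^ 2) * (1 + ‖w‖ ^ 2)) • 1 + (1 + w) ^ 2 * (1 + p) ^ 2) := by
  have hs := star_mul_self_of_re_eq_zero hp
  rw [← smul_mul_assoc, ← mul_smul_comm, one_add_mul_sq_mul_one_add hp hw]
  generalize 1 + p = b, 1 + ‖p‖ ^ 2 = l, 1 + ‖w‖ ^ 2 = m at hs ⊢
  rw [mul_add, add_mul,
    mul_smul_comm, smul_mul_assoc, mul_one, hs, smul_add, smul_comm]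
  congr 1
  rw [← mul_assoc, ← mul_assoc, hs, smul_one_mul, smul_mul_assoc, smul_mul_assoc, sq b,
    mul_assoc]

lemma twist_eq_smul {p x c : ℍ[ℝ]} (hp : p.re = 0) (hx : x.re ≠ 0) (hx1 : ‖x‖ = 1)
    (hc : (1 + ‖p‖ ^ 2) • c = (1 + p) ^ 2)
    (h : 2 * (1 + ‖p‖ ^ 2) * ‖x.re⁻¹ • x.im‖ ≤ 1 - ‖x.re⁻¹ • x.im‖) :
    ∃ r : ℝ, r ≠ 0 ∧ twist p x = r • (1 + x ^ 2 * c) := by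
  have hcut := cutoff_eq_one h
  set w := x.re⁻¹ • x.im with hw
  have hwre : w.re = 0 := by simp [hw]
  have hx' : x = x.re • (1 + w) := by
    rw [hw, smul_add, smul_smul, mul_inv_cancel₀ hx, one_smul]
    conv_lhs => rw [← re_add_im x]
    ext <;> simp
  set D := bendDenom p w with hD
  have hDpos : 0 < D := bendDenom_pos p w
  have hD' : D = 1 - 2 * inner ℝ p w + ‖p‖ ^ 2 * ‖w‖ ^ 2 := by
    rw [hD, bendDenom, hcut]; ring
  have hbend : bend p w = D⁻¹ • (w - ‖w‖ ^ 2 • p) := by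
    rw [bend, hcut, one_mul]
  have hnorm : x.re ^ 2 * (1 + ‖w‖ ^ 2) = 1 := by
    have h1 : ‖1 + w‖ ^ 2 = 1 + ‖w‖ ^ 2 := by
      rw [norm_sq_eq_coords, norm_sq_eq_coords w]
      simp [hwre]
      ring
    have h2 : ‖x.re • (1 + w)‖ ^ 2 = 1 := by rw [← hx', hx1, one_pow]
    rwa [norm_smul, mul_pow, h1, Real.norm_eq_abs, sq_abs] at h2
  have hH : homogenizedBend p x = (x.re * D⁻¹) • (D • 1 + (w - ‖w‖ ^ 2 • p)) := by
    have h1 : (x.re : ℍ[ℝ]) = x.re • (1 : ℍ[ℝ]) := by ext <;> simp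
    rw [homogenizedBend, if_neg hx, ← hw, hbend, ← smul_smul, smul_add D⁻¹, smul_smul D⁻¹ D,
      inv_mul_cancel₀ hDpos.ne', one_smul, smul_add, h1]
  have him : (D • 1 + (w - ‖w‖ ^ 2 • p) : ℍ[ℝ]).im = w - ‖w‖ ^ 2 • p := by
    ext <;> simp [hp, hwre]
  have hre : (D • 1 + (w - ‖w‖ ^ 2 • p) : ℍ[ℝ]).re = D := by simp [hp, hwre]
  have key := tilt_polynomial_identity hp hwre
  rw [← hD', ← hc] at key
  have hsq : x ^ 2 = x.re ^ 2 • (1 + w) ^ 2 := by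
    conv_lhs => rw [hx']
    rw [smul_pow]
  refine ⟨x.re * D⁻¹ * (2⁻¹ * (1 + ‖p‖ ^ 2) ^ 2 * (x.re ^ 2)⁻¹), by positivity, ?_⟩
  rw [twist, hH, tilt_smul, tilt, hre, him, ← smul_smul (x.re * D⁻¹)]
  congr 1
  rw [← inv_smul_smul₀ (two_ne_zero (α := ℝ)) (star (1 + p) * _ * _), key, hsq]
  simp only [smul_add, mul_smul_comm, smul_mul_assoc, smul_smul]
  congr 2
  · field_simp
    linear_combination hnorm
  · field_simp

lemma one_add_sq_of_norm_eq_one {z : ℍ[ℝ]} (hz : ‖z‖ = 1) :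
    (1 + z) ^ 2 = (2 * (1 + z.re)) • z := by
  have h : ‖z‖ ^ 2 = 1 := by rw [hz, one_pow]
  rw [norm_sq_eq_coords] at h
  ext <;> simp [sq]
  · linear_combination -h
  all_goals ring

end Twist

section SphereTwist
open Quaternion Topology

open Classical in
/-- Radial projection to the unit sphere. -/
def unitize (x : ℍ[ℝ]) : S3 :=
  if h : x = 0 then 1 else ⟨‖x‖⁻¹ • x, by
    rw [mem_sphere_zero_iff_norm, norm_smul, norm_inv, norm_norm,
      inv_mul_cancel₀ (norm_ne_zero_iff.2 h)]⟩

lemma coe_unitize {x : ℍ[ℝ]} (h : x ≠ 0) : (unitize x : ℍ[ℝ]) = ‖x‖⁻¹ • x := by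
  rw [unitize, dif_neg h]

lemma norm_coe_S3 (x : S3) : ‖(x : ℍ[ℝ])‖ = 1 := mem_sphere_zero_iff_norm.1 x.2

lemma coe_S3_ne_zero (x : S3) : (x : ℍ[ℝ]) ≠ 0 := ne_zero_of_mem_unit_sphere x

lemma continuousAt_unitize {x : ℍ[ℝ]} (h : x ≠ 0) : ContinuousAt unitize x := by
  rw [Topology.IsInducing.subtypeVal.continuousAt_iff]
  have hc : ContinuousAt (fun y : ℍ[ℝ] => ‖y‖⁻¹ • y) x :=
    (continuous_norm.continuousAt.inv₀ (norm_ne_zero_iff.2 h)).smul continuousAt_id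
  exact hc.congr ((eventually_ne_nhds h).mono
    fun y hy => (coe_unitize hy).symm)

lemma unitize_comp_bijective {f : ℍ[ℝ] → ℍ[ℝ]} (hf : Function.Bijective f) (h0 : f 0 = 0)
    (hs : ∀ (r : ℝ) (x : ℍ[ℝ]), r ≠ 0 → f (r • x) = r • f x) :
    Function.Bijective fun k : S3 => unitize (f k) := by
  have hne : ∀ k : S3, f k ≠ 0 := fun k h =>
    coe_S3_ne_zero k (hf.1 (h.trans h0.symm))
  constructor
  · intro k l h
    have h1 := congrArg (fun s : S3 => (s : ℍ[ℝ])) h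
    simp only [coe_unitize (hne _)] at h1
    have hk : ‖f k‖⁻¹ ≠ 0 := inv_ne_zero (norm_ne_zero_iff.2 (hne k))
    have hl : ‖f l‖⁻¹ ≠ 0 := inv_ne_zero (norm_ne_zero_iff.2 (hne l))
    rw [← hs _ _ hk, ← hs _ _ hl] at h1
    have h2 := hf.1 h1
    have h3 := congrArg norm h2
    rw [norm_smul, norm_smul, norm_coe_S3, norm_coe_S3, mul_one, mul_one, norm_inv, norm_inv,
      norm_norm, norm_norm] at h3
    rw [h3] at h2
    exact Subtype.ext (smul_right_injective _ hl h2)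
  · intro y
    obtain ⟨x, hx⟩ := hf.2 y
    have hx0 : x ≠ 0 := by
      rintro rfl
      exact coe_S3_ne_zero y (hx.symm.trans h0)
    refine ⟨unitize x, Subtype.ext ?_⟩
    have hn : 0 < ‖x‖⁻¹ := inv_pos.2 (norm_pos_iff.2 hx0)
    change (unitize (f (unitize x : ℍ[ℝ])) : ℍ[ℝ]) = y
    rw [coe_unitize (hne _), coe_unitize hx0, hs _ _ hn.ne', hx, norm_smul, norm_coe_S3,
      mul_one, Real.norm_eq_abs, abs_of_pos hn, smul_smul, inv_mul_cancel₀ hn.ne', one_smul]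

/-- Stereographic projection of `S³` from `-1`, with values in the imaginary quaternions. -/
def stereo (c : S3) : ℍ[ℝ] := (1 + (c : ℍ[ℝ]).re)⁻¹ • (c : ℍ[ℝ]).im

lemma re_stereo (c : S3) : (stereo c).re = 0 := by simp [stereo]

lemma one_add_re_pos {c : S3} (hc : c ≠ -1) : 0 < 1 + (c : ℍ[ℝ]).re := by
  have h := norm_sq_eq_coords (c : ℍ[ℝ])
  rw [norm_coe_S3] at h
  by_contra! hle
  apply hc
  have hI := sq_nonneg (c : ℍ[ℝ]).imI
  have hJ := sq_nonneg (c : ℍ[ℝ]).imJ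
  have hK := sq_nonneg (c : ℍ[ℝ]).imK
  have hre : (c : ℍ[ℝ]).re = -1 := by nlinarith
  rw [hre] at h
  refine Subtype.ext ?_
  ext
  · simp [hre]
  · simpa using pow_eq_zero_iff (two_ne_zero) |>.1 (by linarith : (c : ℍ[ℝ]).imI ^ 2 = 0)
  · simpa using pow_eq_zero_iff (two_ne_zero) |>.1 (by linarith : (c : ℍ[ℝ]).imJ ^ 2 = 0)
  · simpa using pow_eq_zero_iff (two_ne_zero) |>.1 (by linarith : (c : ℍ[ℝ]).imK ^ 2 = 0)

lemma continuousAt_stereo {c : S3} (hc : c ≠ -1) : ContinuousAt stereo c := by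
  unfold stereo
  have hre : Continuous fun c : S3 => (c : ℍ[ℝ]).re := continuous_re.comp continuous_subtype_val
  have him : Continuous fun c : S3 => (c : ℍ[ℝ]).im := continuous_im.comp continuous_subtype_val
  exact ((continuous_const.add hre).continuousAt.inv₀ (one_add_re_pos hc).ne').smul
    him.continuousAt

lemma one_add_stereo_sq {c : S3} (hc : c ≠ -1) :
    (1 + ‖stereo c‖ ^ 2) • (c : ℍ[ℝ]) = (1 + stereo c) ^ 2 := by
  have hpos := one_add_re_pos hc
  have h1 : 1 + stereo c = (1 + (c : ℍ[ℝ]).re)⁻¹ • (1 + (c : ℍ[ℝ])) := by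
    rw [eq_inv_smul_iff₀ hpos.ne', smul_add, stereo, smul_inv_smul₀ hpos.ne']
    ext <;> simp
  have h2 : 1 + ‖stereo c‖ ^ 2 = 2 * (1 + (c : ℍ[ℝ]).re)⁻¹ := by
    have h := norm_sq_eq_coords (c : ℍ[ℝ])
    rw [norm_coe_S3] at h
    rw [norm_sq_eq_coords]
    simp only [stereo, re_smul, imI_smul, imJ_smul, imK_smul, smul_eq_mul, re_im, imI_im, imJ_im,
      imK_im]
    field_simp
    linear_combination -h
  rw [h1, h2, smul_pow, one_add_sq_of_norm_eq_one (norm_coe_S3 c), smul_smul]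
  congr 1
  field_simp

/-- A family of self-homeomorphisms of `S³`, parametrized by `c ≠ -1`, with
`sphereTwist c k ^ 2 = k ^ 2 * c` for `k` near `1` and `-1`. -/
def sphereTwist (c k : S3) : S3 := unitize (twist (stereo c) k)

lemma twist_coe_ne_zero (c k : S3) : twist (stereo c) k ≠ 0 := fun h =>
  coe_S3_ne_zero k ((twist_bijective (re_stereo c)).1 (h.trans (twist_zero _).symm))

lemma sphereTwist_bijective (c : S3) : Function.Bijective (sphereTwist c) :=
  unitize_comp_bijective (twist_bijective (re_stereo c)) (twist_zero _)
    fun _ x hr => twist_smul _ hr x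

lemma continuousAt_sphereTwist {c : S3} (hc : c ≠ -1) (k : S3) :
    ContinuousAt (fun q : S3 × S3 => sphereTwist q.1 q.2) (c, k) := by
  have h1 : ContinuousAt (fun q : S3 × S3 => (stereo q.1, (q.2 : ℍ[ℝ]))) (c, k) :=
    (ContinuousAt.comp (f := Prod.fst) (continuousAt_stereo hc) continuousAt_fst).prodMk
      (continuous_subtype_val.comp continuous_snd).continuousAt
  have h2 := ContinuousAt.comp (f := fun q : S3 × S3 => (stereo q.1, (q.2 : ℍ[ℝ])))
    (g := fun q : ℍ[ℝ] × ℍ[ℝ] => twist q.1 q.2) (x := (c, k))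
    (continuousAt_twist (stereo c) (coe_S3_ne_zero k)) h1
  exact ContinuousAt.comp (g := unitize) (continuousAt_unitize (twist_coe_ne_zero c k)) h2

lemma unitize_smul_one_add_sq {r : ℝ} {z : S3} (h : r • (1 + (z : ℍ[ℝ])) ≠ 0) :
    unitize (r • (1 + (z : ℍ[ℝ]))) ^ 2 = z := by
  have hz : z ≠ -1 := by
    rintro rfl
    simp at h
  have hpos := one_add_re_pos hz
  have hr : r ≠ 0 := (smul_ne_zero_iff.1 h).1
  have hn : ‖1 + (z : ℍ[ℝ])‖ ^ 2 = 2 * (1 + (z : ℍ[ℝ]).re) := by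
    have := congrArg norm (one_add_sq_of_norm_eq_one (norm_coe_S3 z))
    rwa [norm_pow, norm_smul, norm_coe_S3, mul_one, Real.norm_eq_abs,
      abs_of_pos (by positivity)] at this
  refine Subtype.ext ?_
  rw [Metric.unitSphere.coe_pow, coe_unitize h, smul_smul, smul_pow,
    one_add_sq_of_norm_eq_one (norm_coe_S3 z), smul_smul, norm_smul, mul_pow, inv_pow, mul_pow,
    hn, Real.norm_eq_abs, sq_abs, mul_inv]
  convert one_smul ℝ (z : ℍ[ℝ])
  field_simp

lemma re_sq_of_sq_eq_one {k : S3} (hk : k ^ 2 = 1) :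
    (k : ℍ[ℝ]).re ≠ 0 ∧ (k : ℍ[ℝ]).im = 0 := by
  have h : (k : ℍ[ℝ]) ^ 2 = 1 := by
    rw [← Metric.unitSphere.coe_pow, hk, Metric.unitSphere.coe_one]
  rcases _root_.sq_eq_one_iff.1 h with h | h <;> rw [h] <;> constructor <;> simp

lemma eventually_sphereTwist_sq {c : S3} (hc : c ≠ -1) {k : S3} (hk : k ^ 2 = 1) :
    ∀ᶠ q : S3 × S3 in 𝓝 (c, k), sphereTwist q.1 q.2 ^ 2 = q.2 ^ 2 * q.1 := by
  obtain ⟨hre, him⟩ := re_sq_of_sq_eq_one hk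
  have hcre : Continuous fun q : S3 × S3 => (q.2 : ℍ[ℝ]).re :=
    continuous_re.comp (continuous_subtype_val.comp continuous_snd)
  have hcim : Continuous fun q : S3 × S3 => (q.2 : ℍ[ℝ]).im :=
    continuous_im.comp (continuous_subtype_val.comp continuous_snd)
  have h1 : ∀ᶠ q : S3 × S3 in 𝓝 (c, k), q.1 ≠ -1 :=
    (isOpen_ne_fun continuous_fst continuous_const).mem_nhds hc
  have h2 : ∀ᶠ q : S3 × S3 in 𝓝 (c, k), (q.2 : ℍ[ℝ]).re ≠ 0 :=
    (isOpen_ne_fun hcre continuous_const).mem_nhds hre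
  have hst : ContinuousAt (fun q : S3 × S3 => stereo q.1) (c, k) :=
    ContinuousAt.comp (f := Prod.fst) (continuousAt_stereo hc) continuousAt_fst
  have hw : ContinuousAt (fun q : S3 × S3 => ‖(q.2 : ℍ[ℝ]).re⁻¹ • (q.2 : ℍ[ℝ]).im‖) (c, k) :=
    ((hcre.continuousAt.inv₀ hre).smul hcim.continuousAt).norm
  have h3 : ∀ᶠ q : S3 × S3 in 𝓝 (c, k),
      2 * (1 + ‖stereo q.1‖ ^ 2) * ‖(q.2 : ℍ[ℝ]).re⁻¹ • (q.2 : ℍ[ℝ]).im‖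
        < 1 - ‖(q.2 : ℍ[ℝ]).re⁻¹ • (q.2 : ℍ[ℝ]).im‖ := by
    refine ContinuousAt.eventually_lt
      ((continuousAt_const.mul (continuousAt_const.add (hst.norm.pow 2))).mul hw)
      (continuousAt_const.sub hw) ?_
    simp [him]
  filter_upwards [h1, h2, h3] with q hq1 hq2 hq3
  obtain ⟨r, hr, hrq⟩ := twist_eq_smul (re_stereo q.1) hq2 (norm_coe_S3 q.2)
    (one_add_stereo_sq hq1) hq3.le
  have hcoe : (q.2 : ℍ[ℝ]) ^ 2 * (q.1 : ℍ[ℝ]) = ((q.2 ^ 2 * q.1 : S3) : ℍ[ℝ]) := by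
    rw [Metric.unitSphere.coe_mul, Metric.unitSphere.coe_pow]
  rw [hcoe] at hrq
  have hne := twist_coe_ne_zero q.1 q.2
  rw [sphereTwist, hrq]
  rw [hrq] at hne
  exact unitize_smul_one_add_sq hne

/-- The fibrewise inverse of `sphereTwist`. -/
def sphereUntwist (c : S3) : S3 → S3 := (Equiv.ofBijective _ (sphereTwist_bijective c)).symm

lemma sphereTwist_sphereUntwist (c h : S3) : sphereTwist c (sphereUntwist c h) = h :=
  (Equiv.ofBijective _ (sphereTwist_bijective c)).apply_symm_apply h

lemma sphereUntwist_sphereTwist (c k : S3) : sphereUntwist c (sphereTwist c k) = k :=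
  (Equiv.ofBijective _ (sphereTwist_bijective c)).symm_apply_apply k

lemma continuousAt_sphereUntwist {c : S3} (hc : c ≠ -1) (h : S3) :
    ContinuousAt (fun q : S3 × S3 => sphereUntwist q.1 q.2) (c, h) := by
  let f : {c : S3 // c ≠ -1} × S3 → {c : S3 // c ≠ -1} × S3 := fun q => (q.1, sphereTwist q.1 q.2)
  have hf : Continuous f := by
    refine continuous_fst.prodMk (continuous_iff_continuousAt.2 fun q => ?_)
    exact ContinuousAt.comp (f := fun q : {c : S3 // c ≠ -1} × S3 => ((q.1 : S3), q.2))
      (g := fun q : S3 × S3 => sphereTwist q.1 q.2) (continuousAt_sphereTwist q.1.2 q.2)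
      (by fun_prop)
  have hp : IsProperMap f := isProperMap_of_comp_of_t2 (g := Prod.fst) hf continuous_fst
    (isProperMap_fst_of_compactSpace : IsProperMap (Prod.fst : {c : S3 // c ≠ -1} × S3 → _))
  let e : {c : S3 // c ≠ -1} × S3 ≃ {c : S3 // c ≠ -1} × S3 :=
    { toFun := f
      invFun := fun q => (q.1, sphereUntwist q.1 q.2)
      left_inv := fun q => Prod.ext rfl (sphereUntwist_sphereTwist q.1.1 q.2)
      right_inv := fun q => Prod.ext rfl (sphereTwist_sphereUntwist q.1.1 q.2) }
  have he : Continuous e.symm :=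
    (e.toHomeomorphOfContinuousClosed hf hp.isClosedMap).symm.continuous
  have ho : Topology.IsOpenEmbedding (Prod.map Subtype.val id : {c : S3 // c ≠ -1} × S3 → S3 × S3) :=
    isOpen_ne.isOpenEmbedding_subtypeVal.prodMap .id
  exact (ho.continuousAt_iff (x := (⟨c, hc⟩, h))).1 (continuous_snd.comp he).continuousAt

lemma two_re_smul_self (a : S3) : (2 * (a : ℍ[ℝ]).re) • (a : ℍ[ℝ]) = 1 + (a : ℍ[ℝ]) ^ 2 := by
  have h := one_add_sq_of_norm_eq_one (norm_coe_S3 a)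
  have h2 : (1 + (a : ℍ[ℝ])) ^ 2 = 1 + (a : ℍ[ℝ]) ^ 2 + (2 : ℝ) • (a : ℍ[ℝ]) := by
    rw [two_smul]; noncomm_ring
  rw [h2, mul_add, mul_one, add_smul, add_comm ((2 : ℝ) • _)] at h
  exact (add_right_cancel h).symm

lemma S3_eq_or_eq_neg_of_sq_eq_sq {a b : S3} (h : a ^ 2 = b ^ 2) (ha : a ^ 2 ≠ -1) :
    a = b ∨ a = -b := by
  have hsq : (a : ℍ[ℝ]) ^ 2 = (b : ℍ[ℝ]) ^ 2 := by
    simpa using congrArg (fun s : S3 => (s : ℍ[ℝ])) h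
  have hab : (2 * (a : ℍ[ℝ]).re) • (a : ℍ[ℝ]) = (2 * (b : ℍ[ℝ]).re) • (b : ℍ[ℝ]) := by
    rw [two_re_smul_self, two_re_smul_self, hsq]
  have hre : 2 * (a : ℍ[ℝ]).re ≠ 0 := fun h0 => ha <| Subtype.ext <| by
    have := two_re_smul_self a
    rw [h0, zero_smul] at this
    simpa using (neg_eq_of_add_eq_zero_right this.symm).symm
  have hn := congrArg norm hab
  rw [norm_smul, norm_smul, norm_coe_S3, norm_coe_S3, mul_one, mul_one, Real.norm_eq_abs,
    Real.norm_eq_abs, abs_eq_abs] at hn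
  rcases hn with hn | hn
  · rw [← hn] at hab
    exact .inl (Subtype.ext (smul_right_injective _ hre hab))
  · rw [← neg_eq_iff_eq_neg.2 hn, neg_smul, ← smul_neg] at hab
    exact .inr (Subtype.ext (smul_right_injective _ hre hab))

lemma S3_neg_one_ne_one : (-1 : S3) ≠ 1 := fun h => by
  have := congrArg (fun s : S3 => (s : ℍ[ℝ]).re) h
  norm_num at this

lemma S3_neg_one_sq : (-1 : S3) ^ 2 = 1 := neg_one_sq

lemma sphereTwist_sq_eq_iff {c : S3} (hc : c ≠ -1) (k : S3) :
    sphereTwist c k ^ 2 = c ↔ k ^ 2 = 1 := by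
  have hroot : ∀ l : S3, l ^ 2 = 1 → sphereTwist c l ^ 2 = c := fun l hl => by
    rw [(eventually_sphereTwist_sq hc hl).self_of_nhds, hl, one_mul]
  refine ⟨fun h => ?_, hroot k⟩
  have hinj := (sphereTwist_bijective c).1
  have h1 := hroot 1 (one_pow 2)
  have h2 := hroot (-1) S3_neg_one_sq
  have hne : sphereTwist c (-1) ≠ sphereTwist c 1 := fun h =>
    S3_neg_one_ne_one (hinj h)
  rcases S3_eq_or_eq_neg_of_sq_eq_sq (h.trans h1.symm) (by rwa [h]) with hk | hk
  · rw [hinj hk, one_pow]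
  · have hneg : sphereTwist c (-1) = -sphereTwist c 1 :=
      (S3_eq_or_eq_neg_of_sq_eq_sq (h2.trans h1.symm) (by rwa [h2])).resolve_left hne
    rw [hinj (hk.trans hneg.symm), S3_neg_one_sq]

end SphereTwist

section Transport
open Topology

/-- `T m d` transports the point `m`, lying in a fibre of `f` other than that over `ε`, to the
fibre over `d ≠ ε`, trivializing `f` away from `ε`. -/
structure IsTransport {M B : Type*} [TopologicalSpace M] [TopologicalSpace B] (f : M → B) (ε : B)
    (T : M → B → M) : Prop where
  map_apply {m : M} {d : B} : f m ≠ ε → d ≠ ε → f (T m d) = d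
  apply_map {m : M} : f m ≠ ε → T m (f m) = m
  apply_apply {m : M} {d e : B} : f m ≠ ε → d ≠ ε → e ≠ ε → T (T m d) e = T m e
  continuousAt {m : M} {d : B} : f m ≠ ε → d ≠ ε →
    ContinuousAt (fun q : M × B => T q.1 q.2) (m, d)

lemma IsTransport.comp_homeomorph {M N B : Type*} [TopologicalSpace M] [TopologicalSpace N]
    [TopologicalSpace B] {f : M → B} {ε : B} {T : M → B → M} (hT : IsTransport f ε T)
    (e : N ≃ₜ M) : IsTransport (f ∘ e) ε fun n d => e.symm (T (e n) d) where
  map_apply hm hd := by simpa using hT.map_apply hm hd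
  apply_map hm := by simp [hT.apply_map hm]
  apply_apply hm hd he := by simpa using hT.apply_apply hm hd he
  continuousAt {m d} hm hd := by
    have h : ContinuousAt (fun q : N × B => (e q.1, q.2)) (m, d) := by fun_prop
    exact e.symm.continuous.continuousAt.comp <|
      ContinuousAt.comp (f := fun q : N × B => (e q.1, q.2)) (g := fun q : M × B => T q.1 q.2)
        (hT.continuousAt hm hd) h

lemma IsTransport.exists_homeomorph {M B : Type*} [TopologicalSpace M] [TopologicalSpace B]
    {f : M → B} {ε δ : B} {T : M → B → M} (hT : IsTransport f ε T) (hf : Continuous f)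
    (hδ : δ ≠ ε) :
    ∃ Φ : (↥{b : B | b ≠ ε} × {m : M // f m = δ}) ≃ₜ {m : M // f m ≠ ε},
      ∀ (c : ↥{b : B | b ≠ ε}) (x : {m : M // f m = δ}), f (Φ (c, x)).val = c := by
  have hx : ∀ x : {m : M // f m = δ}, f x ≠ ε := fun x => x.2.trans_ne hδ
  have hmap : ∀ (c : ↥{b : B | b ≠ ε}) (x : {m : M // f m = δ}), f (T x c) = c := fun c x =>
    hT.map_apply (hx x) c.2
  have hcont : Continuous fun p : ↥{b : B | b ≠ ε} × {m : M // f m = δ} => T p.2 p.1 :=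
    continuous_iff_continuousAt.2 fun p => ContinuousAt.comp
      (f := fun p : ↥{b : B | b ≠ ε} × {m : M // f m = δ} => ((p.2 : M), (p.1 : B)))
      (g := fun q : M × B => T q.1 q.2) (hT.continuousAt (hx p.2) p.1.2) (by fun_prop)
  have hcont' : Continuous fun m : {m : M // f m ≠ ε} => T m δ :=
    continuous_iff_continuousAt.2 fun m => ContinuousAt.comp
      (f := fun m : {m : M // f m ≠ ε} => ((m : M), δ))
      (g := fun q : M × B => T q.1 q.2) (hT.continuousAt m.2 hδ) (by fun_prop)
  refine ⟨
    { toFun := fun p => ⟨T p.2 p.1, (hmap p.1 p.2).trans_ne p.1.2⟩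
      invFun := fun m => (⟨f m, m.2⟩, ⟨T m δ, hT.map_apply m.2 hδ⟩)
      left_inv := fun p => Prod.ext (Subtype.ext (hmap _ _)) <| Subtype.ext <| by
        have h := hT.apply_map (hx p.2)
        rw [p.2.2] at h
        exact (hT.apply_apply (hx p.2) p.1.2 hδ).trans h
      right_inv := fun m => Subtype.ext <|
        (hT.apply_apply m.2 hδ m.2).trans (hT.apply_map m.2)
      continuous_toFun := hcont.subtype_mk fun p => (hmap p.1 p.2).trans_ne p.1.2
      continuous_invFun := Continuous.prodMk
        ((hf.comp continuous_subtype_val).subtype_mk fun m => m.2)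
        (hcont'.subtype_mk fun m => hT.map_apply m.2 hδ) }, hmap⟩

/-- The value that `f` must take to have `f m * h ^ 2 = c`, where `h` is the twist of `k`. -/
def headValue (ε c k : S3) : S3 := c * (sphereTwist (ε * c) k ^ 2)⁻¹

lemma headValue_mul (ε c k : S3) : headValue ε c k * sphereTwist (ε * c) k ^ 2 = c := by
  rw [headValue, inv_mul_cancel_right]

variable {ε : S3}

lemma mul_ne_neg_one {G : Type*} [Monoid G] [HasDistribNeg G] {ε c : G} (h2 : ε * ε = 1)
    (hc : c ≠ -ε) : ε * c ≠ -1 := fun h => hc <| by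
  rw [← one_mul c, ← h2, mul_assoc, h, mul_neg, mul_one]

lemma headValue_eq_iff (h2 : ε * ε = 1) {c : S3} (hc : c ≠ -ε)
    (k : S3) : headValue ε c k = ε ↔ k ^ 2 = 1 := by
  rw [← sphereTwist_sq_eq_iff (mul_ne_neg_one h2 hc), headValue, mul_inv_eq_iff_eq_mul]
  constructor
  · intro h
    conv_rhs => rw [h]
    rw [← mul_assoc, h2, one_mul]
  · intro h
    rw [h, ← mul_assoc, h2, one_mul]

lemma eventually_headValue_eq (h2 : ε * ε = 1) {c : S3}
    (hc : c ≠ -ε) {k : S3} (hk : k ^ 2 = 1) :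
    ∀ᶠ q : S3 × S3 in 𝓝 (c, k), headValue ε q.1 q.2 = ε * (q.2 ^ 2)⁻¹ := by
  have hcont : ContinuousAt (fun q : S3 × S3 => (ε * q.1, q.2)) (c, k) := by fun_prop
  filter_upwards [hcont.eventually (eventually_sphereTwist_sq (mul_ne_neg_one h2 hc) hk)]
    with q hq
  have hq' : sphereTwist (ε * q.1) q.2 ^ 2 = q.2 ^ 2 * (ε * q.1) := hq
  rw [headValue, hq', mul_inv_rev, mul_inv_rev, mul_assoc, mul_inv_cancel_left,
    inv_eq_of_mul_eq_one_left h2]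

variable {M : Type*}

open Classical in
/-- The transport for `f m * h ^ 2` built from a transport for `f`. -/
def twistTransport (f : M → S3) (ε : S3) (T : M → S3 → M) (q : M × S3) (c : S3) : M × S3 :=
  let k := sphereUntwist (ε * (f q.1 * q.2 ^ 2)) q.2
  (if f q.1 = ε then q.1 else T q.1 (headValue ε c k), sphereTwist (ε * c) k)

lemma headValue_sphereUntwist (ε a h : S3) :
    headValue ε (a * h ^ 2) (sphereUntwist (ε * (a * h ^ 2)) h) = a := by
  rw [headValue, sphereTwist_sphereUntwist, mul_inv_cancel_right]

variable [TopologicalSpace M] {f : M → S3} {T : M → S3 → M}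

lemma IsTransport.map_twistTransport_fst (hT : IsTransport f ε T)
    (h2 : ε * ε = 1) {q : M × S3} {c : S3}
    (hq : f q.1 * q.2 ^ 2 ≠ -ε) (hc : c ≠ -ε) :
    f (twistTransport f ε T q c).1
      = headValue ε c (sphereUntwist (ε * (f q.1 * q.2 ^ 2)) q.2) := by
  have h := (headValue_eq_iff h2 hq (sphereUntwist (ε * (f q.1 * q.2 ^ 2)) q.2)).trans
    (headValue_eq_iff h2 hc _).symm
  rw [headValue_sphereUntwist] at h
  unfold twistTransport
  split_ifs with hf
  · exact hf.trans (h.1 hf).symm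
  · exact hT.map_apply hf fun h' => hf (h.2 h')

lemma IsTransport.map_twistTransport (hT : IsTransport f ε T)
    (h2 : ε * ε = 1) {q : M × S3} {c : S3}
    (hq : f q.1 * q.2 ^ 2 ≠ -ε) (hc : c ≠ -ε) :
    f (twistTransport f ε T q c).1 * (twistTransport f ε T q c).2 ^ 2 = c := by
  rw [hT.map_twistTransport_fst h2 hq hc]
  exact headValue_mul _ _ _

lemma IsTransport.continuousAt_twistTransport (hT : IsTransport f ε T) (hf : Continuous f)
    (h2 : ε * ε = 1) {q : M × S3} {c : S3}
    (hq : f q.1 * q.2 ^ 2 ≠ -ε) (hc : c ≠ -ε) :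
    ContinuousAt (fun p : (M × S3) × S3 => twistTransport f ε T p.1 p.2) (q, c) := by
  let k : M × S3 → S3 := fun p => sphereUntwist (ε * (f p.1 * p.2 ^ 2)) p.2
  have hk : ContinuousAt k q :=
    ContinuousAt.comp (f := fun p : M × S3 => (ε * (f p.1 * p.2 ^ 2), p.2))
      (g := fun p : S3 × S3 => sphereUntwist p.1 p.2)
      (continuousAt_sphereUntwist (mul_ne_neg_one h2 hq) q.2) (by fun_prop)
  have hk' : ContinuousAt (fun p : (M × S3) × S3 => k p.1) (q, c) :=
    ContinuousAt.comp (f := Prod.fst) (g := k) (x := (q, c)) hk continuousAt_fst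
  have hh : ContinuousAt (fun p : (M × S3) × S3 => sphereTwist (ε * p.2) (k p.1)) (q, c) :=
    ContinuousAt.comp (f := fun p : (M × S3) × S3 => (ε * p.2, k p.1))
      (g := fun p : S3 × S3 => sphereTwist p.1 p.2)
      (continuousAt_sphereTwist (mul_ne_neg_one h2 hc) (k q))
      ((continuousAt_const.mul continuousAt_snd).prodMk hk')
  have hres : ContinuousAt (fun p : (M × S3) × S3 => headValue ε p.2 (k p.1)) (q, c) :=
    continuousAt_snd.mul (hh.pow 2).inv
  have hfq := headValue_eq_iff h2 hq (k q)
  rw [headValue_sphereUntwist, ← headValue_eq_iff h2 hc] at hfq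
  refine ContinuousAt.prodMk ?_ hh
  by_cases hm : f q.1 = ε
  · have hkq : k q ^ 2 = 1 := (headValue_eq_iff h2 hc _).1 (hfq.1 hm)
    have hpair : ContinuousAt (fun p : M × S3 => (f p.1 * p.2 ^ 2, k p)) q :=
      ContinuousAt.prodMk (by fun_prop) hk
    have e1 : ∀ᶠ p in 𝓝 (q, c), headValue ε (f p.1.1 * p.1.2 ^ 2) (k p.1) = ε * (k p.1 ^ 2)⁻¹ :=
      (continuousAt_fst : ContinuousAt Prod.fst (q, c)).eventually
        (hpair.eventually (eventually_headValue_eq h2 hq hkq))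
    have hpair' : ContinuousAt (fun p : (M × S3) × S3 => (p.2, k p.1)) (q, c) :=
      continuousAt_snd.prodMk hk'
    have e2 : ∀ᶠ p in 𝓝 (q, c), headValue ε p.2 (k p.1) = ε * (k p.1 ^ 2)⁻¹ :=
      hpair'.eventually (eventually_headValue_eq h2 hc hkq)
    refine (continuousAt_fst.fst : ContinuousAt (fun p : (M × S3) × S3 => p.1.1) (q, c)).congr ?_
    filter_upwards [e1, e2] with p hp1 hp2
    split_ifs with hp
    · rfl
    · rw [headValue_sphereUntwist] at hp1
      change p.1.1 = T p.1.1 (headValue ε p.2 (k p.1))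
      rw [hp2, ← hp1, hT.apply_map hp]
  · have h1 : ∀ᶠ p : (M × S3) × S3 in 𝓝 (q, c), f p.1.1 ≠ ε :=
      (isOpen_ne_fun (hf.comp (continuous_fst.comp continuous_fst)) continuous_const).mem_nhds hm
    refine ContinuousAt.congr ?_ (h1.mono fun p hp => (if_neg hp).symm)
    exact ContinuousAt.comp (f := fun p : (M × S3) × S3 => (p.1.1, headValue ε p.2 (k p.1)))
      (g := fun p : M × S3 => T p.1 p.2) (hT.continuousAt hm fun h => hm (hfq.2 h))
      (continuousAt_fst.fst.prodMk hres)

lemma IsTransport.mul_sq (hT : IsTransport f ε T) (hf : Continuous f)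
    (h2 : ε * ε = 1) :
    IsTransport (fun q : M × S3 => f q.1 * q.2 ^ 2) (-ε) (twistTransport f ε T) where
  map_apply hq hc := hT.map_twistTransport h2 hq hc
  apply_map {q} hq := by
    unfold twistTransport
    simp only [headValue_sphereUntwist, sphereTwist_sphereUntwist]
    split_ifs with h
    · rfl
    · rw [hT.apply_map h]
  apply_apply {q c e} hq hc he := by
    have hfst := hT.map_twistTransport_fst h2 hq hc
    have hk : sphereUntwist (ε * (f (twistTransport f ε T q c).1
          * (twistTransport f ε T q c).2 ^ 2)) (twistTransport f ε T q c).2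
        = sphereUntwist (ε * (f q.1 * q.2 ^ 2)) q.2 := by
      rw [hT.map_twistTransport h2 hq hc]
      exact sphereUntwist_sphereTwist _ _
    have h := headValue_eq_iff h2 hq (sphereUntwist (ε * (f q.1 * q.2 ^ 2)) q.2)
    rw [headValue_sphereUntwist] at h
    have hc' := h.trans (headValue_eq_iff h2 hc _).symm
    have he' := h.trans (headValue_eq_iff h2 he _).symm
    rw [twistTransport, hk, hfst]
    refine Prod.ext ?_ rfl
    by_cases hm : f q.1 = ε
    · simp only [twistTransport, if_pos hm, if_pos (hc'.1 hm)]
    · simp only [twistTransport, if_neg hm, if_neg (mt hc'.2 hm)]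
      exact hT.apply_apply hm (mt hc'.2 hm) (mt he'.2 hm)
  continuousAt hq hc := hT.continuousAt_twistTransport hf h2 hq hc

/-- The ordered product of the squares of the entries of a tuple. -/
def prodSq (k : ℕ) (g : Fin k → S3) : S3 := ((List.finRange k).map fun i => g i ^ 2).prod

lemma continuous_prodSq (k : ℕ) : Continuous (prodSq k) :=
  continuous_list_prod _ fun i _ => (continuous_apply i).pow 2

/-- Splitting off the last entry of a tuple. -/
def initLastHomeomorph (k : ℕ) : (Fin (k + 1) → S3) ≃ₜ (Fin k → S3) × S3 where
  toFun g := (Fin.init g, g (Fin.last k))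
  invFun q := Fin.snoc q.1 q.2
  left_inv g := Fin.snoc_init_self g
  right_inv q := Prod.ext (Fin.init_snoc (α := fun _ => S3) _ _)
    (Fin.snoc_last (α := fun _ => S3) _ _)
  continuous_toFun := by unfold Fin.init; fun_prop
  continuous_invFun := Continuous.finSnoc (A := fun _ => S3) continuous_fst continuous_snd

lemma prodSq_succ (k : ℕ) (g : Fin (k + 1) → S3) :
    prodSq (k + 1) g = prodSq k (Fin.init g) * g (Fin.last k) ^ 2 := by
  simp [prodSq, List.finRange_succ_last, List.map_map, Function.comp_def, Fin.init]

lemma exists_isTransport_prodSq (k : ℕ) : ∃ T, IsTransport (prodSq k) ((-1) ^ k) T := by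
  induction k with
  | zero =>
    have h : ∀ g, prodSq 0 g = (-1) ^ 0 := fun g => by simp [prodSq]
    exact ⟨fun m _ => m, fun hm => (hm (h _)).elim, fun hm => (hm (h _)).elim,
      fun hm => (hm (h _)).elim, fun hm => (hm (h _)).elim⟩
  | succ k ih =>
    obtain ⟨T, hT⟩ := ih
    have h := (hT.mul_sq (continuous_prodSq k)
      (by rw [← pow_add, Even.neg_one_pow ⟨k, rfl⟩])).comp_homeomorph (initLastHomeomorph k)
    rw [pow_succ, mul_neg_one, show prodSq (k + 1) = _ from funext (prodSq_succ k)]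
    exact ⟨_, h⟩

end Transport

/-- Over `U = S³ ∖ {(−1)^{n+1}}`, the map `□ₙ` restricts to a trivial fibre bundle with
fibre the regular fibre `Xₙ^r = Xₙ((−1)ⁿ)`. -/
theorem stmt6 (n : ℕ) :
    ∃ Φ : (↥{s : S3 | s ≠ (-1 : S3) ^ (n + 1)} × X n ((-1 : S3) ^ n)) ≃ₜ
        {g : Fin (n + 1) → S3 // box n g ≠ (-1 : S3) ^ (n + 1)},
      ∀ (c : ↥{s : S3 | s ≠ (-1 : S3) ^ (n + 1)}) (x : X n ((-1 : S3) ^ n)),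
        box n (Φ (c, x)).val = (c : S3) := by
  obtain ⟨T, hT⟩ := exists_isTransport_prodSq (n + 1)
  have hne : (-1 : S3) ^ n ≠ (-1) ^ (n + 1) := fun h => by
    rw [pow_succ, left_eq_mul] at h
    exact S3_neg_one_ne_one h
  exact hT.exists_homeomorph (continuous_prodSq (n + 1)) hne
end
end

section
/- Let S²_im = {X ∈ ℍ : re X = 0, ‖X‖ = 1} denote the 2-sphere of purely imaginary unit quaternions, and let T be the circle group. There exists a homeomorphism F : S²_im × T → X₁^r = {(g,h) ∈ S³ × S³ : g²h² = −1} which is equivariant for the actions of S³: F(qXq⁻¹, t) = q•F(X, t) for all unit quaternions q, where S³ acts on X₁^r by componentwise conjugation q•(g,h) = (qgq⁻¹, qhq⁻¹), by conjugation on S²_im, and trivially on the circle factor T. -/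
noncomputable section

/-- The 2-sphere of purely imaginary unit quaternions. -/
abbrev S2im : Type := {X : Quaternion ℝ // X.re = 0 ∧ ‖X‖ = 1}

/-- `T`, the circle group of unit complex numbers. -/
abbrev T1 : Type := Metric.sphere (0 : ℂ) 1

/-- `X₁^r = {(g,h) ∈ S³ × S³ : g²h² = −1}`. -/
abbrev X1r : Type := {p : S3 × S3 // p.1 ^ 2 * p.2 ^ 2 = (-1 : S3)}

lemma Quaternion.mul_self_eq_neg_one_of_re_eq_zero {X : Quaternion ℝ} (hre : X.re = 0)
    (hX : ‖X‖ = 1) : X * X = -1 := by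
  have h1 : X * star X = 1 := by
    rw [Quaternion.self_mul_star, Quaternion.normSq_eq_norm_mul_self, hX]; simp
  have h2 : star X = -X := by
    ext <;> simp [hre]
  rw [h2, mul_neg] at h1
  rw [← h1, neg_neg]

lemma Quaternion.mul_star_eq_one_of_norm {X : Quaternion ℝ} (h : ‖X‖ = 1) : X * star X = 1 := by
  rw [Quaternion.self_mul_star, Quaternion.normSq_eq_norm_mul_self, h]; simp

lemma Quaternion.star_mul_eq_one_of_norm {X : Quaternion ℝ} (h : ‖X‖ = 1) : star X * X = 1 := by
  rw [Quaternion.star_mul_self, Quaternion.normSq_eq_norm_mul_self, h]; simp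

/-- The image of `a + b i` under the embedding `ℂ → ℍ` sending `i` to `X`. -/
def onAxis (X : Quaternion ℝ) (a b : ℝ) : Quaternion ℝ := (a : Quaternion ℝ) + b • X

lemma onAxis_re {X : Quaternion ℝ} (hre : X.re = 0) (a b : ℝ) : (onAxis X a b).re = a := by
  simp [onAxis, hre]

lemma norm_onAxis {X : Quaternion ℝ} (hre : X.re = 0) (hX : ‖X‖ = 1) {a b : ℝ}
    (hab : a ^ 2 + b ^ 2 = 1) : ‖onAxis X a b‖ = 1 := by
  have h1 : ‖onAxis X a b‖ * ‖onAxis X a b‖ = 1 := by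
    have h2 : ‖X‖ * ‖X‖ = 1 := by rw [hX, one_mul]
    rw [← Quaternion.normSq_eq_norm_mul_self, Quaternion.normSq_def'] at h2 ⊢
    simp only [onAxis, Quaternion.re_add, Quaternion.imI_add, Quaternion.imJ_add,
      Quaternion.imK_add, Quaternion.re_smul, Quaternion.imI_smul, Quaternion.imJ_smul,
      Quaternion.imK_smul, Quaternion.re_coe, Quaternion.imI_coe, Quaternion.imJ_coe,
      Quaternion.imK_coe, hre, smul_eq_mul] at h2 ⊢
    linear_combination hab + b ^ 2 * h2
  nlinarith [norm_nonneg (onAxis X a b)]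

lemma onAxis_mul {X : Quaternion ℝ} (hXX : X * X = -1) (a b c d : ℝ) :
    onAxis X a b * onAxis X c d = onAxis X (a * c - b * d) (a * d + b * c) := by
  simp only [onAxis, mul_add, add_mul, smul_mul_smul_comm, hXX, Quaternion.coe_mul_eq_smul,
    Quaternion.mul_coe_eq_smul, Quaternion.coe_sub, Quaternion.coe_mul, smul_smul, add_smul]
  ext <;> simp [Quaternion.re_one, Quaternion.imI_one, Quaternion.imJ_one,
    Quaternion.imK_one] <;> ring

lemma onAxis_mul_swap {X : Quaternion ℝ} (hXX : X * X = -1) {a b : ℝ}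
    (hab : a ^ 2 + b ^ 2 = 1) : onAxis X a b * onAxis X b a = X := by
  rw [onAxis_mul hXX, show a * b - b * a = 0 by ring, show a * a + b * b = 1 by linarith]
  simp [onAxis]

lemma onAxis_sq_mul_sq {X : Quaternion ℝ} (hXX : X * X = -1) {a b : ℝ}
    (hab : a ^ 2 + b ^ 2 = 1) : onAxis X a b ^ 2 * onAxis X b a ^ 2 = -1 := by
  have hc : Commute (onAxis X a b) (onAxis X b a) := by
    rw [commute_iff_eq, onAxis_mul_swap hXX hab, onAxis_mul_swap hXX (by linarith)]
  rw [← hc.mul_pow, onAxis_mul_swap hXX hab, sq, hXX]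

lemma onAxis_conj {q : Quaternion ℝ} (hq : q ≠ 0) (X : Quaternion ℝ) (a b : ℝ) :
    onAxis (q * X * q⁻¹) a b = q * onAxis X a b * q⁻¹ := by
  simp only [onAxis, mul_add, add_mul, mul_smul_comm, smul_mul_assoc]
  rw [← Quaternion.coe_commutes, mul_assoc (a : Quaternion ℝ), mul_inv_cancel₀ hq, mul_one]

section SquareRelation

variable {g h : Quaternion ℝ}

lemma re_smul_add_re_smul_star (hg : ‖g‖ = 1) (hh : ‖h‖ = 1) (hgh : g ^ 2 * h ^ 2 = -1) :
    g.re • g + h.re • star h = 1 := by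
  have hs := Quaternion.mul_star_eq_one_of_norm hh
  have hs' : h ^ 2 * star h ^ 2 = 1 := by
    rw [sq, sq, mul_assoc, ← mul_assoc h (star h), hs, one_mul, hs]
  have h1 : g ^ 2 = -star h ^ 2 := by
    calc g ^ 2 = g ^ 2 * h ^ 2 * star h ^ 2 := by rw [mul_assoc, hs', mul_one]
      _ = -star h ^ 2 := by rw [hgh, neg_one_mul]
  have hsq : ∀ x : Quaternion ℝ, ‖x‖ = 1 → x ^ 2 = (2 * x.re) • x - 1 := by
    intro x hx
    have h2 : x + star x = ((2 * x.re : ℝ) : Quaternion ℝ) := by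
      simpa using Quaternion.self_add_star' x
    rw [← Quaternion.coe_mul_eq_smul, ← h2, add_mul, Quaternion.star_mul_eq_one_of_norm hx, sq,
      add_sub_cancel_right]
  rw [hsq g hg, hsq (star h) (by rwa [norm_star]), Quaternion.re_star, mul_smul, mul_smul] at h1
  have h3 : (2 : ℝ) • (g.re • g + h.re • star h) = (2 : ℝ) • (1 : Quaternion ℝ) := by
    rw [smul_add, two_smul ℝ (1 : Quaternion ℝ), ← sub_eq_zero]
    rw [← sub_eq_zero] at h1
    rw [← h1]; abel
  exact smul_right_injective _ (two_ne_zero' ℝ) h3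

lemma re_sq_add_re_sq (hg : ‖g‖ = 1) (hh : ‖h‖ = 1) (hgh : g ^ 2 * h ^ 2 = -1) :
    g.re ^ 2 + h.re ^ 2 = 1 := by
  have := congrArg (·.re) (re_smul_add_re_smul_star hg hh hgh)
  simpa [sq, Quaternion.re_one] using this

lemma onAxis_mul_re_left (hg : ‖g‖ = 1) (hh : ‖h‖ = 1) (hgh : g ^ 2 * h ^ 2 = -1) :
    onAxis (g * h) g.re h.re = g := by
  have h1 := congrArg (g * star ·) (re_smul_add_re_smul_star hg hh hgh)
  simp only [star_add, Quaternion.star_smul, star_star, star_one, mul_add, mul_smul_comm,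
    Quaternion.mul_star_eq_one_of_norm hg, mul_one] at h1
  rwa [← Quaternion.coe_mul_eq_smul g.re, mul_one] at h1

lemma onAxis_mul_re_right (hg : ‖g‖ = 1) (hh : ‖h‖ = 1) (hgh : g ^ 2 * h ^ 2 = -1) :
    onAxis (g * h) h.re g.re = h := by
  have h1 := congrArg (· * h) (re_smul_add_re_smul_star hg hh hgh)
  simp only [add_mul, smul_mul_assoc, Quaternion.star_mul_eq_one_of_norm hh, one_mul] at h1
  rwa [← Quaternion.coe_mul_eq_smul h.re, mul_one, add_comm] at h1

lemma re_mul_eq_zero (hg : ‖g‖ = 1) (hh : ‖h‖ = 1) (hgh : g ^ 2 * h ^ 2 = -1) :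
    (g * h).re = 0 := by
  have h1 := congrArg (·.re) (onAxis_mul_re_left hg hh hgh)
  have h2 := congrArg (·.re) (onAxis_mul_re_right hg hh hgh)
  simp only [onAxis, Quaternion.re_add, Quaternion.re_coe, Quaternion.re_smul, smul_eq_mul]
    at h1 h2
  linear_combination h.re * h1 + g.re * h2 -
    (g * h).re * re_sq_add_re_sq hg hh hgh

end SquareRelation

lemma T1.re_sq_add_im_sq (t : T1) : (t : ℂ).re ^ 2 + (t : ℂ).im ^ 2 = 1 := by
  have := norm_eq_of_mem_sphere t
  rw [← Complex.sq_norm_sub_sq_im, this]; ring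

lemma X1r.coe_sq_mul_sq (p : X1r) :
    (p.val.1 : Quaternion ℝ) ^ 2 * (p.val.2 : Quaternion ℝ) ^ 2 = -1 :=
  congrArg (Subtype.val : S3 → Quaternion ℝ) p.2

/-- The homeomorphism `(X, a + b i) ↦ (a + b X, b + a X)`, with inverse
`(g, h) ↦ (g h, re g + i re h)`. -/
def axisHomeomorph : (S2im × T1) ≃ₜ X1r where
  toFun p :=
    ⟨(⟨onAxis p.1 (p.2 : ℂ).re (p.2 : ℂ).im, mem_sphere_zero_iff_norm.2
        (norm_onAxis p.1.2.1 p.1.2.2 (T1.re_sq_add_im_sq p.2))⟩,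
      ⟨onAxis p.1 (p.2 : ℂ).im (p.2 : ℂ).re, mem_sphere_zero_iff_norm.2
        (norm_onAxis p.1.2.1 p.1.2.2 ((add_comm _ _).trans (T1.re_sq_add_im_sq p.2)))⟩),
      Subtype.ext (onAxis_sq_mul_sq
        (Quaternion.mul_self_eq_neg_one_of_re_eq_zero p.1.2.1 p.1.2.2)
        (T1.re_sq_add_im_sq p.2))⟩
  invFun p :=
    (⟨p.val.1 * p.val.2,
      re_mul_eq_zero (norm_eq_of_mem_sphere _) (norm_eq_of_mem_sphere _) p.coe_sq_mul_sq,
      by rw [norm_mul, norm_eq_of_mem_sphere, norm_eq_of_mem_sphere, one_mul]⟩,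
     ⟨⟨(p.val.1 : Quaternion ℝ).re, (p.val.2 : Quaternion ℝ).re⟩, by
      rw [mem_sphere_zero_iff_norm, Complex.norm_eq_sqrt_sq_add_sq,
        re_sq_add_re_sq (norm_eq_of_mem_sphere _) (norm_eq_of_mem_sphere _) p.coe_sq_mul_sq,
        Real.sqrt_one]⟩)
  left_inv p := by
    refine Prod.ext (Subtype.ext ?_) (Subtype.ext (Complex.ext ?_ ?_))
    · exact onAxis_mul_swap (Quaternion.mul_self_eq_neg_one_of_re_eq_zero p.1.2.1 p.1.2.2)
        (T1.re_sq_add_im_sq p.2)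
    · exact onAxis_re p.1.2.1 _ _
    · exact onAxis_re p.1.2.1 _ _
  right_inv p := by
    refine Subtype.ext (Prod.ext (Subtype.ext ?_) (Subtype.ext ?_))
    · exact onAxis_mul_re_left (norm_eq_of_mem_sphere _) (norm_eq_of_mem_sphere _)
        p.coe_sq_mul_sq
    · exact onAxis_mul_re_right (norm_eq_of_mem_sphere _) (norm_eq_of_mem_sphere _)
        p.coe_sq_mul_sq
  continuous_toFun := by
    have hre : Continuous fun p : S2im × T1 => (p.2 : ℂ).re := by fun_prop
    have him : Continuous fun p : S2im × T1 => (p.2 : ℂ).im := by fun_prop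
    have hX : Continuous fun p : S2im × T1 => (p.1 : Quaternion ℝ) := by fun_prop
    refine Continuous.subtype_mk (.prodMk (.subtype_mk ?_ _) (.subtype_mk ?_ _)) _
    · exact (Quaternion.continuous_coe.comp hre).add (him.smul hX)
    · exact (Quaternion.continuous_coe.comp him).add (hre.smul hX)
  continuous_invFun := by
    have h1 : Continuous fun p : X1r => (p.val.1 : Quaternion ℝ) := by fun_prop
    have h2 : Continuous fun p : X1r => (p.val.2 : Quaternion ℝ) := by fun_prop
    refine .prodMk (.subtype_mk (h1.mul h2) _) (.subtype_mk ?_ _)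
    exact Complex.equivRealProdCLM.symm.continuous.comp
      ((Quaternion.continuous_re.comp h1).prodMk (Quaternion.continuous_re.comp h2))

/-- There is a homeomorphism `F : S²_im × T → X₁^r` which is equivariant for the
conjugation actions of `S³` (acting trivially on the circle factor). -/
theorem stmt8 :
    ∃ F : (S2im × T1) ≃ₜ X1r,
      ∀ (q : S3) (Y Y' : S2im) (t : T1),
        (Y' : Quaternion ℝ) =
            (q : Quaternion ℝ) * (Y : Quaternion ℝ) * (q : Quaternion ℝ)⁻¹ →
          ((F (Y', t)).val.1 : Quaternion ℝ) =
              (q : Quaternion ℝ) * ((F (Y, t)).val.1 : Quaternion ℝ) * (q : Quaternion ℝ)⁻¹ ∧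
          ((F (Y', t)).val.2 : Quaternion ℝ) =
              (q : Quaternion ℝ) * ((F (Y, t)).val.2 : Quaternion ℝ) * (q : Quaternion ℝ)⁻¹ := by
  refine ⟨axisHomeomorph, fun q Y Y' t hY => ?_⟩
  have hq : (q : Quaternion ℝ) ≠ 0 := ne_zero_of_mem_unit_sphere q
  change onAxis Y' _ _ = _ * onAxis Y _ _ * _ ∧ onAxis Y' _ _ = _ * onAxis Y _ _ * _
  rw [hY]
  exact ⟨onAxis_conj hq _ _ _, onAxis_conj hq _ _ _⟩
end
end

section
/- Fix n ≥ 0 and ε ∈ {1, −1} ⊂ S³, and let ρ : Xₙ(ε) → (S³)ⁿ be the projection (g₀, g₁,…,gₙ) ↦ (g₁,…,gₙ). Then ρ is a continuous closed surjection, and for every (g₁,…,gₙ) ∈ (S³)ⁿ the fibre ρ⁻¹(g₁,…,gₙ) is naturally identified with {g₀ ∈ S³ : g₀² = ε·(g₁²⋯gₙ²)⁻¹}; consequently each fibre either has exactly two elements (when ε·(g₁²⋯gₙ²)⁻¹ ≠ −1) or is homeomorphic to the 2-sphere of purely imaginary unit quaternions (when ε·(g₁²⋯gₙ²)⁻¹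 = −1). -/
noncomputable section

/-- The ordered product `g₁²⋯gₙ²` of the squares of an `n`-tuple. -/
def boxTail (n : ℕ) (y : Fin n → S3) : S3 :=
  ((List.finRange n).map fun i => (y i) ^ 2).prod

/-- The projection `ρ : Xₙ(ε) → (S³)ⁿ`, `(g₀,g₁,…,gₙ) ↦ (g₁,…,gₙ)`. -/
def rho (n : ℕ) (ε : S3) : X n ε → (Fin n → S3) := fun x i => x.val i.succ

theorem Quaternion.mem_unitSphere_iff (q : Quaternion ℝ) :
    q ∈ Metric.sphere (0 : Quaternion ℝ) 1 ↔
      q.re ^ 2 + q.imI ^ 2 + q.imJ ^ 2 + q.imK ^ 2 = 1 := by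
  rw [mem_sphere_zero_iff_norm, ← sq_eq_sq₀ (norm_nonneg _) zero_le_one, pow_two,
    ← Quaternion.normSq_eq_norm_mul_self, Quaternion.normSq_def', one_pow]

theorem S3.sum_sq (g : S3) :
    g.val.re ^ 2 + g.val.imI ^ 2 + g.val.imJ ^ 2 + g.val.imK ^ 2 = 1 :=
  (Quaternion.mem_unitSphere_iff _).1 g.2

theorem S3.sq_eq_iff (g u : S3) :
    g ^ 2 = u ↔ u.val.re = 2 * g.val.re ^ 2 - 1 ∧ u.val.imI = 2 * g.val.re * g.val.imI ∧
      u.val.imJ = 2 * g.val.re * g.val.imJ ∧ u.val.imK = 2 * g.val.re * g.val.imK := by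
  have h := S3.sum_sq g
  rw [Subtype.ext_iff, Metric.unitSphere.coe_pow, pow_two, Quaternion.ext_iff]
  simp only [Quaternion.re_mul, Quaternion.imI_mul, Quaternion.imJ_mul, Quaternion.imK_mul]
  constructor
  · rintro ⟨h1, h2, h3, h4⟩
    refine ⟨?_, ?_, ?_, ?_⟩ <;> linarith
  · rintro ⟨h1, h2, h3, h4⟩
    refine ⟨?_, ?_, ?_, ?_⟩ <;> linarith

theorem S3.sq_eq_neg_one_iff (g : S3) : g ^ 2 = -1 ↔ g.val.re = 0 := by
  rw [S3.sq_eq_iff]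
  simp only [coe_neg_sphere, Metric.unitSphere.coe_one, Quaternion.re_neg, Quaternion.imI_neg,
    Quaternion.imJ_neg, Quaternion.imK_neg, Quaternion.re_one, Quaternion.imI_one,
    Quaternion.imJ_one, Quaternion.imK_one]
  constructor
  · rintro ⟨h, -⟩
    exact pow_eq_zero_iff two_ne_zero |>.1 (by linarith)
  · intro h
    simp [h]

theorem S3.sq_eq_sq {g h : S3} (hg : g ^ 2 ≠ -1) (hgh : h ^ 2 = g ^ 2) : h = g ∨ h = -g := by
  have hre : g.val.re ≠ 0 := mt (S3.sq_eq_neg_one_iff g).2 hg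
  obtain ⟨a0, a1, a2, a3⟩ := (S3.sq_eq_iff h _).1 hgh
  obtain ⟨b0, b1, b2, b3⟩ := (S3.sq_eq_iff g _).1 rfl
  rw [b0] at a0
  rw [b1] at a1
  rw [b2] at a2
  rw [b3] at a3
  rcases sq_eq_sq_iff_eq_or_eq_neg.1 (show h.val.re ^ 2 = g.val.re ^ 2 by linarith) with e | e
  · left
    rw [e] at a1 a2 a3
    ext
    · exact e
    all_goals
      apply mul_left_cancel₀ (mul_ne_zero two_ne_zero hre)
      linarith
  · right
    rw [e] at a1 a2 a3
    ext
    · simpa using e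
    all_goals
      apply mul_left_cancel₀ (mul_ne_zero two_ne_zero hre)
      simp only [coe_neg_sphere, Quaternion.imI_neg, Quaternion.imJ_neg, Quaternion.imK_neg]
      linarith

theorem S3.eq_neg_one_of_re {u : S3} (h : u.val.re = -1) : u = -1 := by
  have hs := S3.sum_sq u
  rw [h] at hs
  ext
  · simpa [Quaternion.re_one] using h
  all_goals
    simp only [coe_neg_sphere, Metric.unitSphere.coe_one, Quaternion.imI_neg,
      Quaternion.imJ_neg, Quaternion.imK_neg, Quaternion.imI_one,
      Quaternion.imJ_one, Quaternion.imK_one, neg_zero]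
    nlinarith [sq_nonneg u.val.imI, sq_nonneg u.val.imJ, sq_nonneg u.val.imK]

theorem S3.exists_sq_eq (u : S3) : ∃ g : S3, g ^ 2 = u := by
  by_cases hu : u = -1
  · refine ⟨⟨⟨0, 1, 0, 0⟩, ?_⟩, ?_⟩
    · refine (Quaternion.mem_unitSphere_iff _).2 ?_
      norm_num
    · rw [hu, S3.sq_eq_neg_one_iff]
  · have hs := S3.sum_sq u
    have hne : u.val.re ≠ -1 := fun h => hu (S3.eq_neg_one_of_re h)
    have hge : -1 ≤ u.val.re := by
      nlinarith [sq_nonneg u.val.imI, sq_nonneg u.val.imJ, sq_nonneg u.val.imK]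
    have hpos : 0 < (u.val.re + 1) / 2 := by
      have := lt_of_le_of_ne hge hne.symm
      linarith
    obtain ⟨r, hr, hr2⟩ : ∃ r : ℝ, r ≠ 0 ∧ r ^ 2 = (u.val.re + 1) / 2 :=
      ⟨_, (Real.sqrt_pos.2 hpos).ne', Real.sq_sqrt hpos.le⟩
    have hre : u.val.re = 2 * r ^ 2 - 1 := by linarith
    refine ⟨⟨⟨r, u.val.imI / (2 * r), u.val.imJ / (2 * r), u.val.imK / (2 * r)⟩, ?_⟩, ?_⟩
    · refine (Quaternion.mem_unitSphere_iff _).2 ?_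
      rw [hre] at hs
      field_simp
      linarith
    · rw [S3.sq_eq_iff]
      refine ⟨hre, ?_, ?_, ?_⟩ <;> field_simp

theorem S3.neg_ne_self (g : S3) : -g ≠ g :=
  (ne_neg_of_mem_unit_sphere ℝ g).symm

theorem S3.neg_sq (g : S3) : (-g) ^ 2 = g ^ 2 :=
  Subtype.ext <| by
    rw [Metric.unitSphere.coe_pow, Metric.unitSphere.coe_pow, coe_neg_sphere, _root_.neg_sq]

theorem S3.ncard_sq_eq {u : S3} (hu : u ≠ -1) : {g : S3 | g ^ 2 = u}.ncard = 2 := by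
  obtain ⟨g, rfl⟩ := S3.exists_sq_eq u
  have : {h : S3 | h ^ 2 = g ^ 2} = {g, -g} := by
    ext h
    refine ⟨S3.sq_eq_sq hu, ?_⟩
    rintro (rfl | rfl)
    · rfl
    · exact S3.neg_sq g
  rw [this, Set.ncard_pair (S3.neg_ne_self g).symm]

/-- The square roots of `-1` in `S³` are the purely imaginary unit quaternions. -/
def S3.sqEqNegOneHomeo : {g : S3 // g ^ 2 = -1} ≃ₜ S2im where
  toFun g := ⟨g.val.val, (S3.sq_eq_neg_one_iff _).1 g.2, mem_sphere_zero_iff_norm.1 g.val.2⟩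
  invFun q := ⟨⟨q.val, mem_sphere_zero_iff_norm.2 q.2.2⟩, (S3.sq_eq_neg_one_iff _).2 q.2.1⟩
  left_inv _ := rfl
  right_inv _ := rfl
  continuous_toFun := by fun_prop
  continuous_invFun := by fun_prop

theorem box_eq (n : ℕ) (g : Fin (n + 1) → S3) :
    box n g = g 0 ^ 2 * boxTail n (fun i => g i.succ) := by
  simp [box, boxTail, List.finRange_succ, Function.comp_def]

theorem continuous_box (n : ℕ) : Continuous (box n) :=
  continuous_list_prod _ fun i _ => (continuous_apply i).pow 2

theorem continuous_rho (n : ℕ) (ε : S3) : Continuous (rho n ε) :=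
  continuous_pi fun i => (continuous_apply i.succ).comp continuous_subtype_val

theorem box_cons_eq_iff (n : ℕ) (ε g : S3) (y : Fin n → S3) :
    box n (Fin.cons g y) = ε ↔ g ^ 2 = ε * (boxTail n y)⁻¹ := by
  simp [box_eq, eq_mul_inv_iff_mul_eq]

/-- The fibre of `ρ` over `y` is identified with a set of square roots by the zeroth coordinate. -/
def rhoFibreHomeo (n : ℕ) (ε : S3) (y : Fin n → S3) :
    {x : X n ε // rho n ε x = y} ≃ₜ {g : S3 // g ^ 2 = ε * (boxTail n y)⁻¹} where
  toFun x := ⟨x.val.val 0, by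
    obtain ⟨⟨g, hg⟩, rfl⟩ := x
    exact eq_mul_inv_of_mul_eq ((box_eq n g).symm.trans hg)⟩
  invFun g := ⟨⟨Fin.cons g.val y, (box_cons_eq_iff n ε g.val y).2 g.2⟩, rfl⟩
  left_inv := by
    rintro ⟨⟨g, hg⟩, rfl⟩
    exact Subtype.ext (Subtype.ext (Fin.cons_self_tail g))
  right_inv _ := rfl
  continuous_toFun := Continuous.subtype_mk ((continuous_apply 0).comp
    (continuous_subtype_val.comp continuous_subtype_val)) _
  continuous_invFun := by
    refine Continuous.subtype_mk (Continuous.subtype_mk (continuous_pi fun i => ?_) _) _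
    refine Fin.cases ?_ (fun j => ?_) i
    · simpa using continuous_subtype_val
    · simpa using continuous_const

theorem isClosedMap_rho (n : ℕ) (ε : S3) : IsClosedMap (rho n ε) := by
  have : CompactSpace (X n ε) :=
    isCompact_iff_compactSpace.1 (isClosed_singleton.preimage (continuous_box n)).isCompact
  exact (continuous_rho n ε).isClosedMap

/-- `ρ` is a continuous closed surjection whose fibre over `(g₁,…,gₙ)` is naturally
identified (via the zeroth coordinate) with `{g₀ : g₀² = ε·(g₁²⋯gₙ²)⁻¹}`; hence each
fibre has exactly two elements, or is homeomorphic to the 2-sphere of purely imaginary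
unit quaternions when `ε·(g₁²⋯gₙ²)⁻¹ = −1`. -/
theorem stmt15 (n : ℕ) (ε : S3) (hε : ε = 1 ∨ ε = -1) :
    Continuous (rho n ε) ∧ IsClosedMap (rho n ε) ∧ Function.Surjective (rho n ε) ∧
    (∀ y : Fin n → S3,
      ∃ e : {x : X n ε // rho n ε x = y} ≃ {g₀ : S3 // g₀ ^ 2 = ε * (boxTail n y)⁻¹},
        ∀ x, (e x).val = x.val.val 0) ∧
    (∀ y : Fin n → S3,
      (ε * (boxTail n y)⁻¹ ≠ -1 → {x : X n ε | rho n ε x = y}.ncard = 2) ∧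
      (ε * (boxTail n y)⁻¹ = -1 →
        Nonempty ({x : X n ε // rho n ε x = y} ≃ₜ S2im))) := by
  refine ⟨continuous_rho n ε, isClosedMap_rho n ε, fun y => ?_,
    fun y => ⟨(rhoFibreHomeo n ε y).toEquiv, fun _ => rfl⟩, fun y => ⟨fun h => ?_, fun h => ?_⟩⟩
  · obtain ⟨g, hg⟩ := S3.exists_sq_eq (ε * (boxTail n y)⁻¹)
    exact ⟨_, ((rhoFibreHomeo n ε y).symm ⟨g, hg⟩).2⟩
  · rw [← S3.ncard_sq_eq h]
    exact Nat.card_congr (rhoFibreHomeo n ε y).toEquiv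
  · have e := rhoFibreHomeo n ε y
    rw [h] at e
    exact ⟨e.trans S3.sqEqNegOneHomeo⟩
end
end
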